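/- arXiv:2505.22237 — 3 statements merged into one kernel-verified Lean document; each statement's English description precedes it below -/
import Mathlib

section
/- Let F be a field of characteristic 2, let a₁, a₂, a₃ ∈ F and b₁, b₂, b₃ ∈ Fˣ. Assume that the tensor product [a₁,b₁)_F ⊗_F [a₂,b₂)_F ⊗_F [a₃,b₃)_F is split (isomorphic as an F-algebra to the algebra of 8×8 matrices over F). Then there exist x₁, y₁, x₂, y₂, x₃, y₃ ∈ F and λ, μ ∈ F such that (a₁ + b₁·(x₁² + x₁y₁ + a₁y₁²)) + (a₂ + b₂·(x₂² + x₂y₂ + a₂y₂²)) = λ² + λ and (a₂ + b₂·(x₂² + x₂y₂ + a₂y₂²)) + (a₃ + b₃·(x₃² + x₃y₃ + a₃y₃²)) = μ² + μ. -/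
open FreeAlgebra in
inductive QuatRel (F : Type*) [Field F] (a b : F) :
    FreeAlgebra F (Fin 2) → FreeAlgebra F (Fin 2) → Prop
  | u_sq : QuatRel F a b (ι F 0 * ι F 0 - ι F 0) (algebraMap F _ a)
  | v_sq : QuatRel F a b (ι F 1 * ι F 1) (algebraMap F _ b)
  | vu : QuatRel F a b (ι F 1 * ι F 0) ((1 - ι F 0) * ι F 1)

/-- The quaternion algebra `[a,b)_F` over a field of characteristic `2`:
generated by `u, v` with `u² - u = a`, `v² = b`, `vu = (1-u)v`. -/
def QuatAlg (F : Type*) [Field F] (a b : F) : Type _ :=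
  RingQuot (QuatRel F a b)

instance (F : Type*) [Field F] (a b : F) : Ring (QuatAlg F a b) :=
  inferInstanceAs (Ring (RingQuot (QuatRel F a b)))

instance (F : Type*) [Field F] (a b : F) : Algebra F (QuatAlg F a b) :=
  inferInstanceAs (Algebra F (RingQuot (QuatRel F a b)))

open scoped TensorProduct

open scoped Quaternion

namespace QuaternionAlgebra

variable {F : Type*} [Field F] {a b : F}

/-- The reduced norm of `[a,b)_F` in characteristic `2`. -/
def charTwoNorm (q : ℍ[F, a, 1, b]) : F :=
  q.re ^ 2 + q.re * q.imI + a * q.imI ^ 2 + b * (q.imJ ^ 2 + q.imJ * q.imK + a * q.imK ^ 2)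

variable (a b) in
/-- The reduced norm is anisotropic, i.e. `[a,b)_F` is a division algebra. -/
def IsDivision : Prop := ∀ q : ℍ[F, a, 1, b], charTwoNorm q = 0 → q = 0

variable (a b) in
/-- In characteristic `2`, `a + b * N(x, y) ≡ c` modulo `℘(F)` for some `x, y : F`, where
`N(x, y) = x ^ 2 + x * y + a * y ^ 2`. -/
def Represents (c : F) : Prop :=
  ∃ x y l : F, a + b * (x ^ 2 + x * y + a * y ^ 2) = c + (l ^ 2 + l)

theorem charTwoNorm_smul (s : F) (q : ℍ[F, a, 1, b]) :
    charTwoNorm (s • q) = s ^ 2 * charTwoNorm q := by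
  simp [charTwoNorm]; ring

theorem eq_smul_one_of_im_eq_zero {q : ℍ[F, a, 1, b]} (hI : q.imI = 0) (hJ : q.imJ = 0)
    (hK : q.imK = 0) : q = q.re • 1 := by
  ext <;> simp [hI, hJ, hK]

theorem represents_self (a b : F) : Represents a b a :=
  ⟨0, 0, 0, by simp⟩

theorem apply_i_apply_i {V : Type*} [AddCommGroup V] [Module F V]
    (ρ : ℍ[F, a, 1, b] →ₐ[F] Module.End F V) (v : V) :
    ρ ⟨0, 1, 0, 0⟩ (ρ ⟨0, 1, 0, 0⟩ v) = ρ ⟨0, 1, 0, 0⟩ v + a • v := by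
  have : (⟨0, 1, 0, 0⟩ : ℍ[F, a, 1, b]) * ⟨0, 1, 0, 0⟩ = ⟨0, 1, 0, 0⟩ + a • 1 := by
    ext <;> simp
  rw [← Module.End.mul_apply, ← map_mul, this]
  simp

variable [CharP F 2]

theorem star_mul_self_charTwo (q : ℍ[F, a, 1, b]) : star q * q = charTwoNorm q • 1 := by
  have h2 : (2 : F) = 0 := CharTwo.two_eq_zero
  ext <;> simp [charTwoNorm] <;> grind

theorem mul_self_charTwo (q : ℍ[F, a, 1, b]) : q * q = q.imI • q + charTwoNorm q • 1 := by
  have h2 : (2 : F) = 0 := CharTwo.two_eq_zero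
  ext <;> simp [charTwoNorm] <;> grind

theorem represents_of_imI_eq_one {q : ℍ[F, a, 1, b]} (hq : q.imI = 1) :
    Represents a b (charTwoNorm q) := by
  have h2 : (2 : F) = 0 := CharTwo.two_eq_zero
  refine ⟨q.imJ, q.imK, q.re, ?_⟩
  simp [charTwoNorm, hq]; grind

theorem represents_of_not_isDivision (hb : b ≠ 0) (h : ¬ IsDivision a b) (c : F) :
    Represents a b c := by
  have h2 : (2 : F) = 0 := CharTwo.two_eq_zero
  obtain ⟨⟨x, y, p, r⟩, hq, hne⟩ : ∃ q : ℍ[F, a, 1, b], charTwoNorm q = 0 ∧ q ≠ 0 := by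
    simpa [IsDivision] using h
  simp only [charTwoNorm] at hq
  have key : ∀ x y : F, (x ≠ 0 ∨ y ≠ 0) → x ^ 2 + x * y + a * y ^ 2 = 0 →
      Represents a b c := by
    intro x y hxy h0
    have hy : y ≠ 0 := by rintro rfl; simp_all
    obtain ⟨t, rfl⟩ : ∃ t, x = t * y := ⟨x / y, by field_simp⟩
    have ha : a = t ^ 2 + t := by
      have : y ^ 2 * (t ^ 2 + t + a) = 0 := by linear_combination h0
      have : t ^ 2 + t + a = 0 := by simpa [hy] using this
      grind
    refine ⟨c / b + t * (c / b + 1), c / b + 1, t, ?_⟩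
    rw [ha]
    field_simp
    grind
  by_cases hN : p ^ 2 + p * r + a * r ^ 2 = 0
  · by_cases hpr : p ≠ 0 ∨ r ≠ 0
    · exact key p r hpr hN
    · refine key x y ?_ (by simpa [hN] using hq)
      by_contra hxy
      push Not at hpr hxy
      exact hne (by ext <;> simp [hpr, hxy])
  · -- The element `(x + y u) * conj (p + r u) / N(p + r u)` of `F[u]` has norm `b`
    set n := p ^ 2 + p * r + a * r ^ 2 with hn
    have hbn : b * n = x ^ 2 + x * y + a * y ^ 2 := by grind
    have hbn0 : b * n ≠ 0 := mul_ne_zero hb hN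
    refine ⟨(c + a) * (p * (x + y) + a * r * y) / (b * n), (c + a) * (p * y + r * x) / (b * n),
      c + a, ?_⟩
    have hmul : (p * (x + y) + a * r * y) ^ 2 + (p * (x + y) + a * r * y) * (p * y + r * x) +
        a * (p * y + r * x) ^ 2 = n * (b * n) := by
      rw [hbn, hn]; grind
    have hnorm : b * (((c + a) * (p * (x + y) + a * r * y) / (b * n)) ^ 2 +
        (c + a) * (p * (x + y) + a * r * y) / (b * n) * ((c + a) * (p * y + r * x) / (b * n)) +
        a * ((c + a) * (p * y + r * x) / (b * n)) ^ 2) = (c + a) ^ 2 := by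
      have : ∀ A B : F, b * (((c + a) * A / (b * n)) ^ 2 +
          (c + a) * A / (b * n) * ((c + a) * B / (b * n)) + a * ((c + a) * B / (b * n)) ^ 2) =
          b * (c + a) ^ 2 * (A ^ 2 + A * B + a * B ^ 2) / (b * n) ^ 2 := by
        intro A B; field_simp
      rw [this, hmul]
      field_simp
    rw [hnorm]
    grind

section TwoAlgebras

variable {a₁ b₁ a₂ b₂ : F}

theorem exists_imI_eq_one_of_charTwoNorm_eq (hb₂ : b₂ ≠ 0) (q₁ : ℍ[F, a₁, 1, b₁])
    (q₂ : ℍ[F, a₂, 1, b₂]) (htr : q₁.imI = q₂.imI) (hnorm : charTwoNorm q₁ = charTwoNorm q₂)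
    (hq₂ : q₂.imJ ≠ 0 ∨ q₂.imK ≠ 0) :
    ∃ (w₁ : ℍ[F, a₁, 1, b₁]) (w₂ : ℍ[F, a₂, 1, b₂]),
      w₁.imI = 1 ∧ w₂.imI = 1 ∧ charTwoNorm w₁ = charTwoNorm w₂ := by
  have h2 : (2 : F) = 0 := CharTwo.two_eq_zero
  by_cases h0 : q₂.imI = 0
  · obtain ⟨g, d, hgd⟩ : ∃ g d : F, q₁.re + q₂.re + b₂ * (q₂.imJ * d + q₂.imK * g) = 1 := by
      rcases hq₂ with h | h
      · refine ⟨0, (1 + q₁.re + q₂.re) / (b₂ * q₂.imJ), ?_⟩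
        field_simp
        grind
      · refine ⟨(1 + q₁.re + q₂.re) / (b₂ * q₂.imK), 0, ?_⟩
        field_simp
        grind
    let e₁ : ℍ[F, a₁, 1, b₁] := ⟨0, 1, 0, 0⟩
    let e₂ : ℍ[F, a₂, 1, b₂] := ⟨0, 1, g, d⟩
    let s := charTwoNorm e₁ + charTwoNorm e₂
    have hs : s = charTwoNorm e₁ + charTwoNorm e₂ := rfl
    refine ⟨e₁ + s • q₁, e₂ + s • q₂, by simp [e₁, htr, h0], by simp [e₂, h0], ?_⟩
    clear_value s
    simp [charTwoNorm, e₁, e₂, htr, h0] at hs hnorm ⊢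
    grind
  · refine ⟨q₂.imI⁻¹ • q₁, q₂.imI⁻¹ • q₂, by simp [htr, h0], by simp [h0], ?_⟩
    rw [charTwoNorm_smul, charTwoNorm_smul, hnorm]

theorem exists_eq_smul_one_add_smul_of_commute {p q : ℍ[F, a, 1, b]} (hb : b ≠ 0)
    (hpq : p * q = q * p) (hq : ∀ s : F, q ≠ s • 1) : ∃ x y : F, p = x • 1 + y • q := by
  have h2 : (2 : F) = 0 := CharTwo.two_eq_zero
  have hre := congr_arg re hpq
  have hJ := congr_arg imJ hpq
  have hK := congr_arg imK hpq
  simp only [re_mul, imJ_mul, imK_mul] at hre hJ hK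
  have hIJ : p.imI * q.imJ = p.imJ * q.imI := by grind
  have hIK : p.imI * q.imK = p.imK * q.imI := by grind
  have hJK : p.imJ * q.imK = p.imK * q.imJ := by
    refine mul_left_cancel₀ hb ?_
    grind
  have aux : ∀ y, p.imI = y * q.imI → p.imJ = y * q.imJ → p.imK = y * q.imK →
      ∃ x y : F, p = x • 1 + y • q := by
    intro y h₁ h₂ h₃
    exact ⟨p.re - y * q.re, y, by ext <;> simp [h₁, h₂, h₃]⟩
  by_cases h₁ : q.imI = 0
  · by_cases h₂ : q.imJ = 0
    · by_cases h₃ : q.imK = 0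
      · exact absurd (eq_smul_one_of_im_eq_zero h₁ h₂ h₃) (hq _)
      · apply aux (p.imK / q.imK) <;> field_simp <;> grind
    · apply aux (p.imJ / q.imJ) <;> field_simp <;> grind
  · apply aux (p.imI / q.imI) <;> field_simp <;> grind

theorem exists_imI_eq_one_of_commute (hb₁ : b₁ ≠ 0) (hb₂ : b₂ ≠ 0)
    (h₂ : IsDivision a₂ b₂) {p q : ℍ[F, a₁, 1, b₁]} (hpq : p * q = q * p)
    (h : p * p + p * q + a₂ • (q * q) = b₂ • 1) :
    ∃ (w₁ : ℍ[F, a₁, 1, b₁]) (w₂ : ℍ[F, a₂, 1, b₂]),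
      w₁.imI = 1 ∧ w₂.imI = 1 ∧ charTwoNorm w₁ = charTwoNorm w₂ := by
  have h2 : (2 : F) = 0 := CharTwo.two_eq_zero
  by_cases hq : ∃ s : F, q = s • 1
  · obtain ⟨s, rfl⟩ := hq
    rw [mul_self_charTwo] at h
    have hre := congr_arg re h
    have hI := congr_arg imI h
    have hJ := congr_arg imJ h
    have hK := congr_arg imK h
    simp at hre hI hJ hK
    have hT : p.imI = s := by
      by_contra hne
      have hne' : p.imI + s ≠ 0 := fun h0 => hne (by grind)
      have hI : p.imI = 0 := by
        refine (mul_eq_zero.mp (?_ : (p.imI + s) * p.imI = 0)).resolve_left hne'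
        linear_combination hI
      have hJ : p.imJ = 0 := by
        refine (mul_eq_zero.mp (?_ : (p.imI + s) * p.imJ = 0)).resolve_left hne'
        linear_combination hJ
      have hK : p.imK = 0 := by
        refine (mul_eq_zero.mp (?_ : (p.imI + s) * p.imK = 0)).resolve_left hne'
        linear_combination hK
      have := h₂ ⟨p.re, s, 1, 0⟩ (by simp [charTwoNorm, hI, hJ, hK] at hre ⊢; grind)
      simpa using congr_arg imJ this
    refine exists_imI_eq_one_of_charTwoNorm_eq hb₂ p ⟨0, s, 1, 0⟩ hT ?_ (by simp)
    simp [charTwoNorm] at hre ⊢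
    grind
  · push Not at hq
    obtain ⟨x, y, rfl⟩ := exists_eq_smul_one_add_smul_of_commute hb₁ hpq hq
    have hcomb : ((y ^ 2 + y + a₂) * q.imI + x) • q +
        ((y ^ 2 + y + a₂) * charTwoNorm q + x ^ 2 + b₂) • (1 : ℍ[F, a₁, 1, b₁]) = 0 := by
      have hexp : (x • 1 + y • q) * (x • 1 + y • q) + (x • 1 + y • q) * q + a₂ • (q * q) =
          (x ^ 2) • (1 : ℍ[F, a₁, 1, b₁]) + (2 * x * y + x) • q + (y ^ 2 + y + a₂) • (q * q) := by
        simp only [add_mul, mul_add, smul_mul_assoc, mul_smul_comm, one_mul, mul_one]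
        module
      rw [hexp, mul_self_charTwo, h2] at h
      have h2' : b₂ • (1 : ℍ[F, a₁, 1, b₁]) + b₂ • 1 = 0 := by
        rw [← add_smul, CharTwo.add_self_eq_zero, zero_smul]
      rw [← h2']
      nth_rewrite 1 [← h]
      module
    have hx : (y ^ 2 + y + a₂) * q.imI + x = 0 := by
      by_contra hne
      refine hq (-((y ^ 2 + y + a₂) * q.imI + x)⁻¹ *
        ((y ^ 2 + y + a₂) * charTwoNorm q + x ^ 2 + b₂)) ?_
      rw [mul_smul, eq_neg_of_add_eq_zero_right hcomb, neg_smul, smul_neg, neg_neg,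
        inv_smul_smul₀ hne]
    have hN : (y ^ 2 + y + a₂) * charTwoNorm q + x ^ 2 + b₂ = 0 := by
      rw [hx] at hcomb
      simpa using congr_arg re hcomb
    refine exists_imI_eq_one_of_charTwoNorm_eq hb₂ ((y ^ 2 + y + a₂) • q) ⟨x * y, x, y, 1⟩ ?_ ?_
      (by simp)
    · simp
      grind
    · rw [charTwoNorm_smul]
      simp only [charTwoNorm] at hN ⊢
      grind

end TwoAlgebras

section Action

open Module

variable {V : Type*} [AddCommGroup V] [Module F V] {ρ : ℍ[F, a, 1, b] →ₐ[F] End F V}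

theorem IsDivision.eq_zero_of_apply_eq_zero (h : IsDivision a b) {q : ℍ[F, a, 1, b]} {v : V}
    (hv : v ≠ 0) (hq : ρ q v = 0) : q = 0 := by
  refine h q ?_
  have : ρ (star q * q) v = 0 := by rw [map_mul, Module.End.mul_apply, hq, map_zero]
  rw [star_mul_self_charTwo, map_smul, map_one] at this
  exact (smul_eq_zero.mp this).resolve_right hv

theorem injective_of_nontrivial [Nontrivial V] (hb : b ≠ 0) : Function.Injective ρ := by
  have h2 : (2 : F) = 0 := CharTwo.two_eq_zero
  rw [injective_iff_map_eq_zero]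
  intro q hq
  have hunit : ∀ s : F, ρ (s • 1) = 0 → s = 0 := by
    intro s hs
    rw [map_smul, map_one] at hs
    exact (smul_eq_zero.mp hs).resolve_right one_ne_zero
  let I : ℍ[F, a, 1, b] := ⟨0, 1, 0, 0⟩
  let J : ℍ[F, a, 1, b] := ⟨0, 0, 1, 0⟩
  have comm : ∀ x y : ℍ[F, a, 1, b], ρ y = 0 → ρ (x * y + y * x) = 0 := by
    intro x y hy
    simp [hy]
  have hK : q.imK = 0 := by
    have h₁ := comm J _ (comm I q hq)
    have : J * (I * q + q * I) + (I * q + q * I) * J = (b * q.imK) • 1 := by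
      ext <;> simp [I, J] <;> grind
    rw [this] at h₁
    simpa [hb] using hunit _ h₁
  have hJ : q.imJ = 0 := by
    have h₁ : ρ ((I * q + q * I) * J) = 0 := by rw [map_mul, comm I q hq, zero_mul]
    have : (I * q + q * I) * J = (b * q.imJ) • 1 := by
      ext <;> simp [I, J, hK] <;> grind
    rw [this] at h₁
    simpa [hb] using hunit _ h₁
  have hI : q.imI = 0 := by
    have h₁ : ρ ((J * q + q * J) * J) = 0 := by rw [map_mul, comm J q hq, zero_mul]
    have : (J * q + q * J) * J = (b * q.imI) • 1 := by
      ext <;> simp [J, hK, hJ] <;> grind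
    rw [this] at h₁
    simpa [hb] using hunit _ h₁
  rw [eq_smul_one_of_im_eq_zero hI hJ hK] at hq ⊢
  rw [hunit _ hq, zero_smul]

theorem IsDivision.imI_eq_one_of_apply_eq (h : IsDivision a b) {f : End F V}
    (hf : ∀ q v, f (ρ q v) = ρ q (f v)) {c : F} {r : ℍ[F, a, 1, b]} {v : V} (hv : v ≠ 0)
    (hfv : f (f v) = f v + c • v) (hr : f v = ρ r v) (hne : ∀ l : F, f v ≠ l • v) :
    r.imI = 1 ∧ charTwoNorm r = c := by
  have h2 : (2 : F) = 0 := CharTwo.two_eq_zero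
  have h0 : r * r - r - c • 1 = 0 := by
    refine h.eq_zero_of_apply_eq_zero (ρ := ρ) hv ?_
    simp [← hr, ← hf, hfv]
  rw [mul_self_charTwo] at h0
  have hre := congr_arg re h0
  have hI := congr_arg imI h0
  have hJ := congr_arg imJ h0
  have hK := congr_arg imK h0
  simp at hre hI hJ hK
  have hT : r.imI = 1 := by
    by_contra hT
    have hT' : r.imI - 1 ≠ 0 := sub_ne_zero.mpr hT
    have hI : r.imI = 0 := by
      refine (mul_eq_zero.mp (?_ : (r.imI - 1) * r.imI = 0)).resolve_left hT'
      linear_combination hI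
    have hJ : r.imJ = 0 := by
      refine (mul_eq_zero.mp (?_ : (r.imI - 1) * r.imJ = 0)).resolve_left hT'
      linear_combination hJ
    have hK : r.imK = 0 := by
      refine (mul_eq_zero.mp (?_ : (r.imI - 1) * r.imK = 0)).resolve_left hT'
      linear_combination hK
    refine hne r.re ?_
    rw [hr]
    conv_lhs => rw [eq_smul_one_of_im_eq_zero hI hJ hK]
    simp
  refine ⟨hT, ?_⟩
  rw [hT] at hre
  linear_combination hre

theorem represents_of_finrank_le_four [FiniteDimensional F V] (hb : b ≠ 0) {f : End F V}
    (hf : ∀ q v, f (ρ q v) = ρ q (f v)) {c : F} {U : Submodule F V} (hU : finrank F U ≤ 4)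
    (hρU : ∀ q, ∀ v ∈ U, ρ q v ∈ U) {u : V} (hu : u ∈ U) (hfU : f u ∈ U)
    (hfu : f (f u) = f u + c • u) (hne : ∀ l : F, f u ≠ l • u) : Represents a b c := by
  by_cases h : IsDivision a b
  · have hu0 : u ≠ 0 := by
      rintro rfl
      simpa using hne 0
    let φ : ℍ[F, a, 1, b] →ₗ[F] V := (LinearMap.applyₗ u).comp ρ.toLinearMap
    have hφ : ∀ q, φ q = ρ q u := fun q => rfl
    have hinj : Function.Injective φ := by
      rw [injective_iff_map_eq_zero]
      exact fun q hq => h.eq_zero_of_apply_eq_zero hu0 hq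
    have hle : LinearMap.range φ ≤ U := by
      rintro _ ⟨q, rfl⟩
      exact hρU q u hu
    have hrange : LinearMap.range φ = U := by
      refine Submodule.eq_of_le_of_finrank_le hle ?_
      rw [LinearMap.finrank_range_of_inj hinj, finrank_eq_four]
      exact hU
    obtain ⟨r, hr⟩ : f u ∈ LinearMap.range φ := hrange ▸ hfU
    obtain ⟨h₁, rfl⟩ := h.imI_eq_one_of_apply_eq hf hu0 hfu hr.symm hne
    exact represents_of_imI_eq_one h₁
  · exact represents_of_not_isDivision hb h c

theorem exists_apply_i_ne_smul (hb : b ≠ 0) {U : Submodule F V} (hU : U ≠ ⊥)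
    (hρU : ∀ q, ∀ v ∈ U, ρ q v ∈ U) :
    ∃ u ∈ U, ∀ l : F, ρ ⟨0, 1, 0, 0⟩ u ≠ l • u := by
  have h2 : (2 : F) = 0 := CharTwo.two_eq_zero
  obtain ⟨u, hu, hu0⟩ := U.exists_mem_ne_zero_of_ne_bot hU
  by_cases h : ∀ l : F, ρ ⟨0, 1, 0, 0⟩ u ≠ l • u
  · exact ⟨u, hu, h⟩
  push Not at h
  obtain ⟨m, hm⟩ := h
  have hJu : ρ ⟨0, 1, 0, 0⟩ (ρ ⟨0, 0, 1, 0⟩ u) = (m + 1) • ρ ⟨0, 0, 1, 0⟩ u := by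
    have : (⟨0, 1, 0, 0⟩ : ℍ[F, a, 1, b]) * ⟨0, 0, 1, 0⟩ =
        ⟨0, 0, 1, 0⟩ * ⟨0, 1, 0, 0⟩ + ⟨0, 0, 1, 0⟩ := by
      ext <;> simp <;> grind
    rw [← Module.End.mul_apply, ← map_mul, this, map_add, map_mul, LinearMap.add_apply,
      Module.End.mul_apply, hm, map_smul, add_smul, one_smul]
  have hJ : ρ ⟨0, 0, 1, 0⟩ (ρ ⟨0, 0, 1, 0⟩ u) = b • u := by
    have : (⟨0, 0, 1, 0⟩ : ℍ[F, a, 1, b]) * ⟨0, 0, 1, 0⟩ = b • 1 := by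
      ext <;> simp
    rw [← Module.End.mul_apply, ← map_mul, this]
    simp
  refine ⟨u + ρ ⟨0, 0, 1, 0⟩ u, U.add_mem hu (hρU _ _ hu), fun l hl => ?_⟩
  rw [map_add, hm, hJu] at hl
  set w := ρ ⟨0, 0, 1, 0⟩ u
  have hw0 : w ≠ 0 := by
    intro hw
    rw [hw, map_zero] at hJ
    exact smul_ne_zero hb hu0 hJ.symm
  have h₁ : (m - l) • u + (m + 1 - l) • w = 0 := by
    linear_combination (norm := module) hl
  have h₃ := congr_arg (ρ ⟨0, 1, 0, 0⟩) h₁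
  rw [map_add, map_smul, map_smul, hm, hJu, map_zero] at h₃
  have h₄ : (m - l) • u = 0 := by
    linear_combination (norm := module) (m + 1) • h₁ - h₃
  have hml := (smul_eq_zero.mp h₄).resolve_right hu0
  rw [h₄, zero_add, add_sub_right_comm, hml, zero_add, one_smul] at h₁
  exact hw0 h₁

end Action

section ThreeAlgebras

open Module

variable {V : Type*} [AddCommGroup V] [Module F V] {a₁ b₁ a₂ b₂ a₃ b₃ : F}
  {ρ₁ : ℍ[F, a₁, 1, b₁] →ₐ[F] End F V} {ρ₂ : ℍ[F, a₂, 1, b₂] →ₐ[F] End F V}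
  {ρ₃ : ℍ[F, a₃, 1, b₃] →ₐ[F] End F V}

theorem exists_represents_of_not_isDivision (hb₁ : b₁ ≠ 0) (hb₂ : b₂ ≠ 0) (hb₃ : b₃ ≠ 0)
    (h₁₂ : ∀ p q v, ρ₁ p (ρ₂ q v) = ρ₂ q (ρ₁ p v)) (h₁₃ : ∀ p q v, ρ₁ p (ρ₃ q v) = ρ₃ q (ρ₁ p v))
    (h₂₃ : ∀ p q v, ρ₂ p (ρ₃ q v) = ρ₃ q (ρ₂ p v)) (hV : finrank F V = 8)
    (h₁ : ¬ IsDivision a₁ b₁) :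
    ∃ c, Represents a₁ b₁ c ∧ Represents a₂ b₂ c ∧ Represents a₃ b₃ c := by
  have : FiniteDimensional F V := .of_finrank_pos (by omega)
  have : Nontrivial V := Module.nontrivial_of_finrank_pos (R := F) (by omega)
  refine ⟨a₂, represents_of_not_isDivision hb₁ h₁ a₂, represents_self a₂ b₂, ?_⟩
  obtain ⟨z, hz, hz0⟩ : ∃ q : ℍ[F, a₁, 1, b₁], charTwoNorm q = 0 ∧ q ≠ 0 := by
    simpa [IsDivision] using h₁
  have hinj : ∀ q : ℍ[F, a₁, 1, b₁], q ≠ 0 → ρ₁ q ≠ 0 := fun q hq =>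
    (map_ne_zero_iff ρ₁ (injective_of_nontrivial hb₁)).mpr hq
  obtain ⟨U, hU, hU4, hU₂, hU₃⟩ : ∃ U : Submodule F V, U ≠ ⊥ ∧ finrank F U ≤ 4 ∧
      (∀ q, ∀ v ∈ U, ρ₂ q v ∈ U) ∧ (∀ q, ∀ v ∈ U, ρ₃ q v ∈ U) := by
    have hrank := LinearMap.finrank_range_add_finrank_ker (ρ₁ z)
    by_cases hker : finrank F (LinearMap.ker (ρ₁ z)) ≤ 4
    · refine ⟨LinearMap.ker (ρ₁ z), fun hbot => ?_, hker, fun q v hv => ?_, fun q v hv => ?_⟩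
      · refine hinj z hz0 ?_
        have hzz : ρ₁ z * ρ₁ (star z) = 0 := by
          have := star_mul_self_charTwo (star z)
          rw [star_star] at this
          rw [← map_mul, ← star_comm_self', star_mul_self_charTwo, hz, zero_smul, map_zero]
        have : ρ₁ (star z) = 0 := by
          ext v
          have : ρ₁ (star z) v ∈ LinearMap.ker (ρ₁ z) := LinearMap.congr_fun hzz v
          rwa [hbot, Submodule.mem_bot] at this
        exact absurd this (hinj _ (star_ne_zero.mpr hz0))
      · rw [LinearMap.mem_ker] at hv ⊢
        rw [h₁₂, hv, map_zero]
      · rw [LinearMap.mem_ker] at hv ⊢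
        rw [h₁₃, hv, map_zero]
    · refine ⟨LinearMap.range (ρ₁ z), fun hbot => hinj z hz0 (LinearMap.range_eq_bot.mp hbot),
        by omega, ?_, ?_⟩
      · rintro q _ ⟨v, rfl⟩
        exact ⟨ρ₂ q v, h₁₂ z q v⟩
      · rintro q _ ⟨v, rfl⟩
        exact ⟨ρ₃ q v, h₁₃ z q v⟩
  obtain ⟨u, hu, hne⟩ := exists_apply_i_ne_smul hb₂ hU hU₂
  exact represents_of_finrank_le_four hb₃ (fun q v => h₂₃ _ q v) hU4 hU₃ hu (hU₂ _ u hu)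
    (apply_i_apply_i ρ₂ u) hne

theorem IsDivision.apply_ne_smul (h : IsDivision a b) {ρ : ℍ[F, a, 1, b] →ₐ[F] End F V}
    {w : ℍ[F, a, 1, b]} (hw : w.imI = 1) {v : V} (hv : v ≠ 0) (l : F) : ρ w v ≠ l • v := by
  intro hl
  have : w - l • 1 = 0 := h.eq_zero_of_apply_eq_zero (ρ := ρ) hv (by simp [hl])
  simpa [hw] using congr_arg imI this

theorem exists_imI_eq_one_charTwoNorm_eq (hb₁ : b₁ ≠ 0) (hb₂ : b₂ ≠ 0)
    (h₁ : IsDivision a₁ b₁) (h₂ : IsDivision a₂ b₂)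
    (h₁₂ : ∀ p q v, ρ₁ p (ρ₂ q v) = ρ₂ q (ρ₁ p v)) (hV : finrank F V = 8) :
    ∃ (w₁ : ℍ[F, a₁, 1, b₁]) (w₂ : ℍ[F, a₂, 1, b₂]),
      w₁.imI = 1 ∧ w₂.imI = 1 ∧ charTwoNorm w₁ = charTwoNorm w₂ := by
  have h2 : (2 : F) = 0 := CharTwo.two_eq_zero
  have : FiniteDimensional F V := .of_finrank_pos (by omega)
  have : Nontrivial V := Module.nontrivial_of_finrank_pos (R := F) (by omega)
  obtain ⟨v, hv⟩ := exists_ne (0 : V)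
  set I : ℍ[F, a₂, 1, b₂] := ⟨0, 1, 0, 0⟩ with hI
  set J : ℍ[F, a₂, 1, b₂] := ⟨0, 0, 1, 0⟩ with hJ
  have hII : ρ₂ I (ρ₂ I v) = ρ₂ I v + a₂ • v := apply_i_apply_i ρ₂ v
  let ev : V → ℍ[F, a₁, 1, b₁] →ₗ[F] V := fun u => (LinearMap.applyₗ u).comp ρ₁.toLinearMap
  let φ : ℍ[F, a₁, 1, b₁] × ℍ[F, a₁, 1, b₁] →ₗ[F] V := (ev v).coprod (ev (ρ₂ I v))
  have hφ : ∀ p q, φ (p, q) = ρ₁ p v + ρ₁ q (ρ₂ I v) := fun p q => rfl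
  by_cases hinj : Function.Injective φ
  · have hdim : finrank F (ℍ[F, a₁, 1, b₁] × ℍ[F, a₁, 1, b₁]) = finrank F V := by
      rw [finrank_prod, finrank_eq_four, hV]
    obtain ⟨⟨p, q⟩, hpq⟩ := (LinearMap.injective_iff_surjective_of_finrank_eq_finrank hdim).mp hinj
      (ρ₂ J v)
    rw [hφ] at hpq
    have hJJ : ρ₂ J (ρ₂ J v) = b₂ • v := by
      have : J * J = b₂ • 1 := by ext <;> simp [J]
      rw [← Module.End.mul_apply, ← map_mul, this]
      simp
    have hJI : ρ₂ J (ρ₂ I v) = ρ₂ J v + ρ₂ I (ρ₂ J v) := by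
      have : J * I = J + I * J := by ext <;> simp [I, J] <;> grind
      rw [← Module.End.mul_apply, ← map_mul, this]
      simp
    have hexp : b₂ • v = ρ₁ (p * p + q * p + a₂ • (q * q)) v +
        ρ₁ (p * q + q * p + q * q + q * q) (ρ₂ I v) := by
      rw [← hJJ, ← hpq, map_add, ← h₁₂, ← h₁₂, hJI, ← hpq]
      simp only [map_add, map_mul, map_smul, LinearMap.add_apply, LinearMap.smul_apply,
        Module.End.mul_apply, ← h₁₂, hII]
      abel
    have h0 := @hinj (p * p + q * p + a₂ • (q * q), p * q + q * p + q * q + q * q) (b₂ • 1, 0) (by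
      rw [hφ, hφ, ← hexp]; simp)
    rw [Prod.mk.injEq] at h0
    have hself : ∀ x : ℍ[F, a₁, 1, b₁], x + x = 0 := by
      intro x
      rw [← two_smul F x, h2, zero_smul]
    have hcomm : p * q = q * p := by
      have := h0.2
      rw [add_assoc, hself, add_zero] at this
      exact add_right_cancel (this.trans (hself (q * p)).symm)
    exact exists_imI_eq_one_of_commute hb₁ hb₂ h₂ hcomm (hcomm ▸ h0.1)
  · obtain ⟨⟨p, q⟩, hpq, hne⟩ : ∃ x, φ x = 0 ∧ x ≠ 0 := by
      rw [injective_iff_map_eq_zero] at hinj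
      push Not at hinj
      exact hinj
    rw [hφ] at hpq
    have hq : q ≠ 0 := by
      rintro rfl
      have hp : p = 0 := h₁.eq_zero_of_apply_eq_zero (ρ := ρ₁) hv (by simpa using hpq)
      exact hne (by rw [hp]; rfl)
    have hn : charTwoNorm q ≠ 0 := fun h => hq (h₁ q h)
    have hr : ρ₂ I v = ρ₁ (-(charTwoNorm q)⁻¹ • (star q * p)) v := by
      rw [map_smul, map_mul, LinearMap.smul_apply, Module.End.mul_apply,
        eq_neg_of_add_eq_zero_left hpq, map_neg, ← Module.End.mul_apply, ← map_mul,
        star_mul_self_charTwo]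
      simp [hn]
    obtain ⟨htr, hnorm⟩ := h₁.imI_eq_one_of_apply_eq (f := ρ₂ I) (fun p u => (h₁₂ p I u).symm) hv
      hII hr (h₂.apply_ne_smul rfl hv)
    exact ⟨_, I, htr, rfl, hnorm.trans (by simp [charTwoNorm, I])⟩

theorem exists_represents_of_isDivision (hb₁ : b₁ ≠ 0) (hb₂ : b₂ ≠ 0) (hb₃ : b₃ ≠ 0)
    (h₁ : IsDivision a₁ b₁) (h₂ : IsDivision a₂ b₂)
    (h₁₂ : ∀ p q v, ρ₁ p (ρ₂ q v) = ρ₂ q (ρ₁ p v)) (h₁₃ : ∀ p q v, ρ₁ p (ρ₃ q v) = ρ₃ q (ρ₁ p v))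
    (h₂₃ : ∀ p q v, ρ₂ p (ρ₃ q v) = ρ₃ q (ρ₂ p v)) (hV : finrank F V = 8) :
    ∃ c, Represents a₁ b₁ c ∧ Represents a₂ b₂ c ∧ Represents a₃ b₃ c := by
  have h2 : (2 : F) = 0 := CharTwo.two_eq_zero
  have : FiniteDimensional F V := .of_finrank_pos (by omega)
  have : Nontrivial V := Module.nontrivial_of_finrank_pos (R := F) (by omega)
  have hself : ∀ x : V, x + x = 0 := fun x => by rw [← two_smul F x, h2, zero_smul]
  obtain ⟨w₁, w₂, hw₁, hw₂, hw⟩ := exists_imI_eq_one_charTwoNorm_eq hb₁ hb₂ h₁ h₂ h₁₂ hV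
  refine ⟨charTwoNorm w₁, represents_of_imI_eq_one hw₁, hw ▸ represents_of_imI_eq_one hw₂, ?_⟩
  have hsq₁ : ∀ v, ρ₁ w₁ (ρ₁ w₁ v) = ρ₁ w₁ v + charTwoNorm w₁ • v := fun v => by
    rw [← Module.End.mul_apply, ← map_mul, mul_self_charTwo, hw₁]
    simp
  have hsq₂ : ∀ v, ρ₂ w₂ (ρ₂ w₂ v) = ρ₂ w₂ v + charTwoNorm w₁ • v := fun v => by
    rw [← Module.End.mul_apply, ← map_mul, mul_self_charTwo, hw₂, hw]
    simp
  let e : End F V := ρ₁ w₁ + ρ₂ w₂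
  have he : ∀ v, e v = ρ₁ w₁ v + ρ₂ w₂ v := fun v => rfl
  have hee : ∀ v, e (e v) = e v := fun v => by
    simp only [he, map_add, hsq₁, hsq₂, h₁₂]
    linear_combination (norm := module) hself (charTwoNorm w₁ • v) + hself (ρ₂ w₂ (ρ₁ w₁ v))
  let j : ℍ[F, a₁, 1, b₁] := ⟨b₁ * w₁.imK, 0, 1, 0⟩
  have hj : ∀ v, v ≠ 0 → ρ₁ j v ≠ 0 := fun v hv hjv => by
    simpa [j] using congr_arg imJ (h₁.eq_zero_of_apply_eq_zero hv hjv)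
  have hej : ∀ v, e (ρ₁ j v) = ρ₁ j (e v) + ρ₁ j v := fun v => by
    have : w₁ * j = j * w₁ + j := by
      ext <;> simp [j, hw₁] <;> grind
    rw [he, he, map_add, ← h₁₂, ← Module.End.mul_apply, ← map_mul, this, map_add, map_mul,
      LinearMap.add_apply, Module.End.mul_apply]
    abel
  let U := LinearMap.ker e
  have hmem : ∀ v, v ∈ U ↔ e v = 0 := fun v => LinearMap.mem_ker
  have hU4 : finrank F U ≤ 4 := by
    have hinj : Function.Injective (ρ₁ j) := by
      rw [injective_iff_map_eq_zero]
      exact fun v hv => not_imp_not.mp (hj v) hv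
    have hmap : finrank F (U.map (ρ₁ j)) = finrank F U :=
      (Submodule.equivMapOfInjective _ hinj U).finrank_eq.symm
    have hdisj : Disjoint U (U.map (ρ₁ j)) := by
      rw [Submodule.disjoint_def]
      rintro _ hx ⟨y, hy, rfl⟩
      rw [hmem, hej, (hmem y).mp hy, map_zero, zero_add] at hx
      exact hx
    have hle := Submodule.finrank_add_finrank_le_of_disjoint hdisj
    omega
  obtain ⟨u, hu, hu0⟩ : ∃ u ∈ U, u ≠ 0 := by
    obtain ⟨v, hv⟩ := exists_ne (0 : V)
    by_cases hev : e v = 0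
    · exact ⟨v, hev, hv⟩
    · exact ⟨ρ₁ j (e v), by rw [hmem, hej, hee, hself], hj _ hev⟩
  refine represents_of_finrank_le_four hb₃ (fun q v => h₁₃ w₁ q v) hU4 (fun q v hv => ?_) hu ?_
    (hsq₁ u) (h₁.apply_ne_smul hw₁ hu0)
  · rw [hmem] at hv ⊢
    rw [he, h₁₃, h₂₃, ← map_add, ← he, hv, map_zero]
  · rw [hmem] at hu ⊢
    rw [he, ← h₁₂, ← map_add, ← he, hu, map_zero]

theorem exists_represents (hb₁ : b₁ ≠ 0) (hb₂ : b₂ ≠ 0) (hb₃ : b₃ ≠ 0)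
    (h₁₂ : ∀ p q v, ρ₁ p (ρ₂ q v) = ρ₂ q (ρ₁ p v)) (h₁₃ : ∀ p q v, ρ₁ p (ρ₃ q v) = ρ₃ q (ρ₁ p v))
    (h₂₃ : ∀ p q v, ρ₂ p (ρ₃ q v) = ρ₃ q (ρ₂ p v)) (hV : finrank F V = 8) :
    ∃ c, Represents a₁ b₁ c ∧ Represents a₂ b₂ c ∧ Represents a₃ b₃ c := by
  by_cases h₁ : IsDivision a₁ b₁
  · by_cases h₂ : IsDivision a₂ b₂
    · exact exists_represents_of_isDivision hb₁ hb₂ hb₃ h₁ h₂ h₁₂ h₁₃ h₂₃ hV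
    · obtain ⟨c, hc₂, hc₁, hc₃⟩ := exists_represents_of_not_isDivision hb₂ hb₁ hb₃
        (fun p q v => (h₁₂ q p v).symm) h₂₃ h₁₃ hV h₂
      exact ⟨c, hc₁, hc₂, hc₃⟩
  · exact exists_represents_of_not_isDivision hb₁ hb₂ hb₃ h₁₂ h₁₃ h₂₃ hV h₁

end ThreeAlgebras

end QuaternionAlgebra

/-- The canonical homomorphism from Mathlib's quaternion algebra with `i ^ 2 = a + i`,
`j ^ 2 = b` to `[a,b)_F`, sending `i` to `u` and `j` to `v`. -/
noncomputable def QuatAlg.ofQuaternionAlgebra (F : Type*) [Field F] (a b : F) :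
    ℍ[F, a, 1, b] →ₐ[F] QuatAlg F a b :=
  QuaternionAlgebra.Basis.liftHom
    (let π : FreeAlgebra F (Fin 2) →ₐ[F] QuatAlg F a b := RingQuot.mkAlgHom F (QuatRel F a b)
    have hu : π (FreeAlgebra.ι F 0) * π (FreeAlgebra.ι F 0) - π (FreeAlgebra.ι F 0) =
        algebraMap F _ a := by
      have := RingQuot.mkAlgHom_rel F (QuatRel.u_sq (F := F) (a := a) (b := b))
      rw [← map_mul, ← map_sub, ← π.commutes]
      exact this
    have hv : π (FreeAlgebra.ι F 1) * π (FreeAlgebra.ι F 1) = algebraMap F _ b := by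
      have := RingQuot.mkAlgHom_rel F (QuatRel.v_sq (F := F) (a := a) (b := b))
      rw [← map_mul, ← π.commutes]
      exact this
    have hvu : π (FreeAlgebra.ι F 1) * π (FreeAlgebra.ι F 0) =
        (1 - π (FreeAlgebra.ι F 0)) * π (FreeAlgebra.ι F 1) := by
      have := RingQuot.mkAlgHom_rel F (QuatRel.vu (F := F) (a := a) (b := b))
      rw [← map_mul, ← map_one π, ← map_sub, ← map_mul]
      exact this
    { i := π (FreeAlgebra.ι F 0)
      j := π (FreeAlgebra.ι F 1)
      k := π (FreeAlgebra.ι F 0) * π (FreeAlgebra.ι F 1)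
      i_mul_i := by rw [one_smul, ← Algebra.algebraMap_eq_smul_one, ← hu, sub_add_cancel]
      j_mul_j := by rw [hv, Algebra.algebraMap_eq_smul_one]
      i_mul_j := rfl
      j_mul_i := by rw [one_smul, hvu, sub_mul, one_mul] })

theorem stmt2 (F : Type*) [Field F] [CharP F 2] (a₁ a₂ a₃ : F) (b₁ b₂ b₃ : F)
    (hb₁ : b₁ ≠ 0) (hb₂ : b₂ ≠ 0) (hb₃ : b₃ ≠ 0)
    (hsplit : Nonempty
      (((QuatAlg F a₁ b₁ ⊗[F] QuatAlg F a₂ b₂) ⊗[F] QuatAlg F a₃ b₃) ≃ₐ[F]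
        Matrix (Fin 8) (Fin 8) F)) :
    ∃ x₁ y₁ x₂ y₂ x₃ y₃ l m : F,
      (a₁ + b₁ * (x₁ ^ 2 + x₁ * y₁ + a₁ * y₁ ^ 2)) +
        (a₂ + b₂ * (x₂ ^ 2 + x₂ * y₂ + a₂ * y₂ ^ 2)) = l ^ 2 + l ∧
      (a₂ + b₂ * (x₂ ^ 2 + x₂ * y₂ + a₂ * y₂ ^ 2)) +
        (a₃ + b₃ * (x₃ ^ 2 + x₃ * y₃ + a₃ * y₃ ^ 2)) = m ^ 2 + m := by
  
  obtain ⟨e⟩ := hsplit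
  let ψ : ((QuatAlg F a₁ b₁ ⊗[F] QuatAlg F a₂ b₂) ⊗[F] QuatAlg F a₃ b₃) →ₐ[F]
      Module.End F (Fin 8 → F) := (Matrix.toLinAlgEquiv'.toAlgHom).comp e.toAlgHom
  let ρ₁ := ψ.comp ((Algebra.TensorProduct.includeLeft.comp
    Algebra.TensorProduct.includeLeft).comp (QuatAlg.ofQuaternionAlgebra F a₁ b₁))
  let ρ₂ := ψ.comp ((Algebra.TensorProduct.includeLeft.comp
    Algebra.TensorProduct.includeRight).comp (QuatAlg.ofQuaternionAlgebra F a₂ b₂))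
  let ρ₃ := ψ.comp (Algebra.TensorProduct.includeRight.comp
    (QuatAlg.ofQuaternionAlgebra F a₃ b₃))
  obtain ⟨c, ⟨x₁, y₁, l₁, h₁⟩, ⟨x₂, y₂, l₂, h₂⟩, ⟨x₃, y₃, l₃, h₃⟩⟩ :=
    QuaternionAlgebra.exists_represents (ρ₁ := ρ₁) (ρ₂ := ρ₂) (ρ₃ := ρ₃) hb₁ hb₂ hb₃
      (fun p q v => by
        simp only [ρ₁, ρ₂, AlgHom.comp_apply, ← Module.End.mul_apply, ← map_mul]
        simp)
      (fun p q v => by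
        simp only [ρ₁, ρ₃, AlgHom.comp_apply, ← Module.End.mul_apply, ← map_mul]
        simp)
      (fun p q v => by
        simp only [ρ₂, ρ₃, AlgHom.comp_apply, ← Module.End.mul_apply, ← map_mul]
        simp)
      (by simp)
  have h2 : (2 : F) = 0 := CharTwo.two_eq_zero
  refine ⟨x₁, y₁, x₂, y₂, x₃, y₃, l₁ + l₂, l₂ + l₃, ?_, ?_⟩
  · rw [h₁, h₂]
    linear_combination (c - l₁ * l₂) * h2
  · rw [h₂, h₃]
    linear_combination (c - l₂ * l₃) * h2
end

section
/- Let F be a field of characteristic 2, let a₁, a₂, a₃, a₄ ∈ F and b₁, b₂, b₃, b₄ ∈ Fˣ. Assume that the tensor product [a₁,b₁)_F ⊗_F [a₂,b₂)_F ⊗_F [a₃,b₃)_F ⊗_F [a₄,b₄)_F is split (isomorphic as an F-algebra to the algebra of 16×16 matrices over F). Then there exist λ ∈ F and xᵢ, yᵢ ∈ F for 1 ≤ i ≤ 4 such that λ² + λ + a₁ + a₂ + a₃ + a₄ + Σ_{i=1}^{4} bᵢ·(xᵢ² + xᵢyᵢ + aᵢyᵢ²) = 0. -/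
open scoped TensorProduct

section Spinor

variable {K : Type*} [Field K]

/-- Negate the `i`-th coordinate. -/
def flipAt (i : Fin 4) (I : Fin 4 → Bool) : Fin 4 → Bool :=
  fun j => if j = i then !I j else I j

theorem flipAt_involutive (i : Fin 4) : Function.Involutive (flipAt i) := by
  intro I; ext j; by_cases h : j = i <;> simp [flipAt, h]

/-- The action of the `10`-dimensional quadratic space on its half-spin representation, realized on
functions on `{0,1}⁴`: `l + m ∑ pᵢ + ∑ xᵢ wᵢ + ∑ yᵢ pᵢ wᵢ`, where `wᵢ` flips the `i`-th coordinate
and `pᵢ` restricts to the points whose `i`-th coordinate is `true`. -/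
def spinorAct (l m : K) (x y : Fin 4 → K) (f : (Fin 4 → Bool) → K) (I : Fin 4 → Bool) : K :=
  l * f I + m * ∑ i, (if I i then f I else 0) + ∑ i, x i * f (flipAt i I) +
    ∑ i, y i * (if I i then f (flipAt i I) else 0)

/-- The pairing on the even part; with `oddForm`, `creationForm` and `annihilationForm` its diagonal
gives the coordinates of the equivariant quadratic map from spinors to isotropic vectors. -/
def evenForm (f g : (Fin 4 → Bool) → K) : K :=
  f ![false, false, false, false] * g ![true, true, true, true] +
  f ![true, true, false, false] * g ![false, false, true, true] +
  f ![true, false, true, false] * g ![false, true, false, true] +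
  f ![true, false, false, true] * g ![false, true, true, false]

/-- The pairing on the odd part. -/
def oddForm (f g : (Fin 4 → Bool) → K) : K :=
  f ![true, false, false, false] * g ![false, true, true, true] +
  f ![false, true, false, false] * g ![true, false, true, true] +
  f ![false, false, true, false] * g ![true, true, false, true] +
  f ![false, false, false, true] * g ![true, true, true, false]

/-- The coordinates along the operators `pᵢ wᵢ`. -/
def creationForm (f g : (Fin 4 → Bool) → K) : Fin 4 → K := ![
  f ![true, false, false, false] * g ![true, true, true, true] +
  f ![true, true, false, false] * g ![true, false, true, true] +
  f ![true, false, true, false] * g ![true, true, false, true] +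
  f ![true, false, false, true] * g ![true, true, true, false],
  f ![false, true, false, false] * g ![true, true, true, true] +
  f ![true, true, false, false] * g ![false, true, true, true] +
  f ![false, true, true, false] * g ![true, true, false, true] +
  f ![false, true, false, true] * g ![true, true, true, false],
  f ![false, false, true, false] * g ![true, true, true, true] +
  f ![true, false, true, false] * g ![false, true, true, true] +
  f ![false, true, true, false] * g ![true, false, true, true] +
  f ![false, false, true, true] * g ![true, true, true, false],
  f ![false, false, false, true] * g ![true, true, true, true] +
  f ![true, false, false, true] * g ![false, true, true, true] +
  f ![false, true, false, true] * g ![true, false, true, true] +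
  f ![false, false, true, true] * g ![true, true, false, true]]

/-- The coordinates along the operators `(1 + pᵢ) wᵢ`. -/
def annihilationForm (f g : (Fin 4 → Bool) → K) : Fin 4 → K := ![
  f ![false, false, false, false] * g ![false, true, true, true] +
  f ![false, true, false, false] * g ![false, false, true, true] +
  f ![false, false, true, false] * g ![false, true, false, true] +
  f ![false, false, false, true] * g ![false, true, true, false],
  f ![false, false, false, false] * g ![true, false, true, true] +
  f ![true, false, false, false] * g ![false, false, true, true] +
  f ![false, false, true, false] * g ![true, false, false, true] +
  f ![false, false, false, true] * g ![true, false, true, false],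
  f ![false, false, false, false] * g ![true, true, false, true] +
  f ![true, false, false, false] * g ![false, true, false, true] +
  f ![false, true, false, false] * g ![true, false, false, true] +
  f ![false, false, false, true] * g ![true, true, false, false],
  f ![false, false, false, false] * g ![true, true, true, false] +
  f ![true, false, false, false] * g ![false, true, true, false] +
  f ![false, true, false, false] * g ![true, false, true, false] +
  f ![false, false, true, false] * g ![true, true, false, false]]

theorem flipAt_zero (a b c d : Bool) : flipAt 0 ![a, b, c, d] = ![!a, b, c, d] := by
  revert a b c d; decide
theorem flipAt_one (a b c d : Bool) : flipAt 1 ![a, b, c, d] = ![a, !b, c, d] := by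
  revert a b c d; decide
theorem flipAt_two (a b c d : Bool) : flipAt 2 ![a, b, c, d] = ![a, b, !c, d] := by
  revert a b c d; decide
theorem flipAt_three (a b c d : Bool) : flipAt 3 ![a, b, c, d] = ![a, b, c, !d] := by
  revert a b c d; decide

theorem forall_bool4 {P : (Fin 4 → Bool) → Prop} (h : ∀ a b c d, P ![a, b, c, d]) (I) : P I := by
  have : I = ![I 0, I 1, I 2, I 3] := by ext i; fin_cases i <;> rfl
  rw [this]; exact h _ _ _ _

set_option maxHeartbeats 4000000 in
/-- The linearization in direction `g` of the identity `q(f) · f = 0`, where `q` is the quadratic map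
from spinors to vectors. -/
theorem polar_identity [CharP K 2] (f g : (Fin 4 → Bool) → K) (I : Fin 4 → Bool) :
    spinorAct (oddForm f f) (evenForm f f + oddForm f f) (annihilationForm f f)
      (creationForm f f + annihilationForm f f) g I +
    spinorAct (oddForm f g + oddForm g f)
      (evenForm f g + evenForm g f + (oddForm f g + oddForm g f))
      (annihilationForm f g + annihilationForm g f)
      (creationForm f g + creationForm g f + (annihilationForm f g + annihilationForm g f)) f I = 0 := by
  revert I
  apply forall_bool4
  intro a b c d
  have h2 : (2 : K) = 0 := CharTwo.two_eq_zero
  have h4 : (4 : K) = 0 := by linear_combination 2 * h2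
  have h6 : (6 : K) = 0 := by linear_combination 3 * h2
  have h8 : (8 : K) = 0 := by linear_combination 4 * h2
  cases a <;> cases b <;> cases c <;> cases d <;>
    simp only [spinorAct, Fin.sum_univ_four, flipAt_zero, flipAt_one, flipAt_two, flipAt_three,
      evenForm, oddForm, creationForm, annihilationForm, Pi.add_apply, Bool.not_true,
      Bool.not_false, Matrix.cons_val, if_true,
      Bool.false_eq_true, if_false] <;> ring_nf <;>
    simp only [h2, h4, h6, h8, mul_zero, add_zero]


/-- Every spinor is annihilated by a nonzero vector. -/
theorem exists_spinorAct_eq_zero [CharP K 2] (f : (Fin 4 → Bool) → K) :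
    ∃ (l m : K) (x y : Fin 4 → K), (l ≠ 0 ∨ m ≠ 0 ∨ x ≠ 0 ∨ y ≠ 0) ∧
      ∀ I, spinorAct l m x y f I = 0 := by
  by_contra! H
  have key (l m : K) (x y : Fin 4 → K) (h : ∀ I, spinorAct l m x y f I = 0) :
      l = 0 ∧ m = 0 ∧ x = 0 ∧ y = 0 := by
    by_contra h'
    obtain ⟨I, hI⟩ := H l m x y (by tauto)
    exact hI (h I)
  have hff := key (oddForm f f) (evenForm f f + oddForm f f) (annihilationForm f f)
      (creationForm f f + annihilationForm f f) fun I ↦ by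
    simpa [spinorAct, CharTwo.add_self_eq_zero] using polar_identity f f I
  obtain ⟨h1, h2, h3, h4⟩ := hff
  have hfg (g : (Fin 4 → Bool) → K) :
      oddForm f g + oddForm g f = 0 ∧ evenForm f g + evenForm g f = 0 := by
    have := key (oddForm f g + oddForm g f)
      (evenForm f g + evenForm g f + (oddForm f g + oddForm g f))
      (annihilationForm f g + annihilationForm g f)
      (creationForm f g + creationForm g f + (annihilationForm f g + annihilationForm g f)) fun I ↦ by
        have := polar_identity f g I
        rw [h2, h4, h1, h3] at this
        simpa [spinorAct] using this
    refine ⟨this.1, ?_⟩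
    simpa [this.1] using this.2.1
  have hf : f = 0 := by
    ext I
    have h := hfg (Pi.single (fun i ↦ !I i) 1)
    revert I
    apply forall_bool4
    intro a b c d h
    have hI : (fun i ↦ !(![a, b, c, d] : Fin 4 → Bool) i) = ![!a, !b, !c, !d] := by
      ext i; fin_cases i <;> rfl
    rw [hI] at h
    revert h
    cases a <;> cases b <;> cases c <;> cases d <;> simp [oddForm, evenForm]
  exact one_ne_zero (key 1 0 0 0 (by simp [spinorAct, hf])).1

end Spinor

section System

/-- Generators `u i, v i` of four pairwise commuting quaternion algebras `[a i, b i)`. -/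
structure QuaternionSystem {R A : Type*} [CommRing R] [Ring A] [Algebra R A]
    (a b : Fin 4 → R) (u v : Fin 4 → A) : Prop where
  u_mul_u (i : Fin 4) : u i * u i = u i + algebraMap R A (a i)
  v_mul_v (i : Fin 4) : v i * v i = algebraMap R A (b i)
  v_mul_u (i : Fin 4) : v i * u i = (1 - u i) * v i
  u_comm_u {i j : Fin 4} (h : i ≠ j) : u i * u j = u j * u i
  u_comm_v {i j : Fin 4} (h : i ≠ j) : u i * v j = v j * u i
  v_comm_v {i j : Fin 4} (h : i ≠ j) : v i * v j = v j * v i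

variable {K W : Type*} [Field K] [AddCommGroup W] [Module K W]
  {p w : Fin 4 → Module.End K W}

/-- The basis vector indexed by `I` obtained from a vacuum vector `x`. -/
def spinorVec (w : Fin 4 → Module.End K W) (x : W) (I : Fin 4 → Bool) : W :=
  (w 0 ^ (I 0).toNat) ((w 1 ^ (I 1).toNat) ((w 2 ^ (I 2).toNat) ((w 3 ^ (I 3).toNat) x)))

namespace QuaternionSystem

section Normalized

variable (h : QuaternionSystem (0 : Fin 4 → K) 1 p w)
include h

theorem p_p_apply (i : Fin 4) (x : W) : p i (p i x) = p i x := by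
  simpa using LinearMap.congr_fun (h.u_mul_u i) x

theorem w_w_apply (i : Fin 4) (x : W) : w i (w i x) = x := by
  simpa using LinearMap.congr_fun (h.v_mul_v i) x

theorem p_w_apply_self (i : Fin 4) (x : W) : p i (w i x) = w i x - w i (p i x) := by
  have := LinearMap.congr_fun (h.v_mul_u i) x
  simp only [Module.End.mul_apply, LinearMap.sub_apply, Module.End.one_apply] at this
  rw [this]; abel

theorem p_w_apply {i j : Fin 4} (hij : i ≠ j) (x : W) : p i (w j x) = w j (p i x) :=
  LinearMap.congr_fun (h.u_comm_v hij) x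

theorem w_w_comm {i j : Fin 4} (hij : i ≠ j) (x : W) : w i (w j x) = w j (w i x) :=
  LinearMap.congr_fun (h.v_comm_v hij) x

theorem w_injective (i : Fin 4) : Function.Injective (w i) :=
  Function.LeftInverse.injective (h.w_w_apply i)

theorem exists_vacuum [Nontrivial W] : ∃ x : W, x ≠ 0 ∧ ∀ i, p i x = 0 := by
  suffices H : ∀ S : Finset (Fin 4), ∃ x : W, x ≠ 0 ∧ ∀ i ∈ S, p i x = 0 by
    simpa using H Finset.univ
  intro S
  induction S using Finset.induction_on with
  | empty => simpa using exists_ne (0 : W)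
  | insert i S hi ih =>
    obtain ⟨x, hx, hS⟩ := ih
    by_cases hp : p i x = 0
    · exact ⟨x, hx, by simpa [hp] using hS⟩
    · refine ⟨w i (p i x), fun h0 ↦ hp (h.w_injective i (by simpa using h0)), ?_⟩
      simp only [Finset.mem_insert, forall_eq_or_imp]
      refine ⟨by rw [h.p_w_apply_self, h.p_p_apply, sub_self], fun j hj ↦ ?_⟩
      have hji : j ≠ i := by rintro rfl; exact hi hj
      have := LinearMap.congr_fun (h.u_comm_u hji) x
      simp only [Module.End.mul_apply] at this
      rw [h.p_w_apply hji, this, hS j hj, map_zero, map_zero]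

theorem w_apply_spinorVec (i : Fin 4) (x : W) (I : Fin 4 → Bool) :
    w i (spinorVec w x I) = spinorVec w x (flipAt i I) := by
  revert I
  apply forall_bool4
  intro a b c d
  fin_cases i <;> cases a <;> cases b <;> cases c <;> cases d <;>
    simp [spinorVec, flipAt, h.w_w_apply, h.w_w_comm (show (1 : Fin 4) ≠ 0 by decide),
      h.w_w_comm (show (2 : Fin 4) ≠ 0 by decide), h.w_w_comm (show (3 : Fin 4) ≠ 0 by decide),
      h.w_w_comm (show (2 : Fin 4) ≠ 1 by decide), h.w_w_comm (show (3 : Fin 4) ≠ 1 by decide),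
      h.w_w_comm (show (3 : Fin 4) ≠ 2 by decide)]

theorem p_apply_w_pow {i j : Fin 4} (hij : i ≠ j) (n : ℕ) (x : W) :
    p i ((w j ^ n) x) = (w j ^ n) (p i x) :=
  LinearMap.congr_fun (Commute.pow_right (h.u_comm_v hij) n) x

theorem p_apply_w_pow_self (i : Fin 4) (b : Bool) (x : W) (hx : p i x = 0) :
    p i ((w i ^ b.toNat) x) = if b then (w i ^ b.toNat) x else 0 := by
  cases b <;> simp [hx, h.p_w_apply_self]

theorem p_apply_spinorVec {x : W} (hx : ∀ i, p i x = 0) (i : Fin 4) (I : Fin 4 → Bool) :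
    p i (spinorVec w x I) = if I i then spinorVec w x I else 0 := by
  unfold spinorVec
  fin_cases i <;>
    simp only [Fin.zero_eta, Fin.mk_one, Fin.reduceFinMk, ne_eq, Fin.reduceEq, not_false_eq_true,
      zero_ne_one, one_ne_zero, h.p_apply_w_pow, h.p_apply_w_pow_self, hx, map_zero] <;>
    split_ifs <;> simp

theorem spinorVec_ne_zero {x : W} (hx : x ≠ 0) (I : Fin 4 → Bool) : spinorVec w x I ≠ 0 := by
  have H (i : Fin 4) (n : ℕ) : Function.Injective (w i ^ n) := by
    rw [Module.End.coe_pow]; exact (h.w_injective i).iterate n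
  unfold spinorVec
  simpa only [ne_eq, map_eq_zero_iff _ (H _ _)] using hx

theorem linearIndependent_spinorVec {x : W} (hx0 : x ≠ 0) (hx : ∀ i, p i x = 0) :
    LinearIndependent K (spinorVec w x) := by
  rw [Fintype.linearIndependent_iff]
  intro g hg I
  have step (i : Fin 4) (c : (Fin 4 → Bool) → K) (hc : ∑ J, c J • spinorVec w x J = 0) :
      ∑ J, (if J i = I i then c J else 0) • spinorVec w x J = 0 := by
    have hp : ∑ J, (if J i then c J else 0) • spinorVec w x J = 0 := by
      simpa [h.p_apply_spinorVec hx, ite_smul] using congrArg (p i) hc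
    cases hI : I i
    · rw [← sub_eq_zero.2 (hc.trans hp.symm), ← Finset.sum_sub_distrib]
      refine Finset.sum_congr rfl fun J _ ↦ ?_
      cases J i <;> simp
    · exact hp
  have key := step 0 _ (step 1 _ (step 2 _ (step 3 _ hg)))
  rw [Finset.sum_eq_single I] at key
  · simpa [h.spinorVec_ne_zero hx0] using key
  · intro J _ hJ
    have : ∃ i, J i ≠ I i := Function.ne_iff.1 hJ
    obtain ⟨i, hi⟩ := this
    fin_cases i <;> simp_all
  · simp

theorem exists_relation [CharP K 2] (hW : Module.finrank K W = 16) (s : W) :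
    ∃ (l m : K) (x y : Fin 4 → K), (l ≠ 0 ∨ m ≠ 0 ∨ x ≠ 0 ∨ y ≠ 0) ∧
      l • s + m • ∑ i, p i s + ∑ i, x i • w i s + ∑ i, y i • p i (w i s) = 0 := by
  have : Nontrivial W := Module.nontrivial_of_finrank_pos (R := K) (by omega)
  obtain ⟨x₀, hx0, hx⟩ := h.exists_vacuum
  let B := basisOfLinearIndependentOfCardEqFinrank (h.linearIndependent_spinorVec hx0 hx)
    (by simp [hW])
  have hB (I) : B I = spinorVec w x₀ I := by simp [B]
  obtain ⟨f, rfl⟩ : ∃ f : (Fin 4 → Bool) → K, s = ∑ I, f I • spinorVec w x₀ I :=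
    ⟨B.repr s, by simp_rw [← hB]; exact (B.sum_repr s).symm⟩
  obtain ⟨l, m, x, y, hne, H⟩ := exists_spinorAct_eq_zero f
  refine ⟨l, m, x, y, hne, ?_⟩
  have hp (i) (f : (Fin 4 → Bool) → K) : p i (∑ I, f I • spinorVec w x₀ I) =
      ∑ I, (if I i then f I else 0) • spinorVec w x₀ I := by
    simp [h.p_apply_spinorVec hx, ite_smul]
  have hw (i) (f : (Fin 4 → Bool) → K) : w i (∑ I, f I • spinorVec w x₀ I) =
      ∑ I, f (flipAt i I) • spinorVec w x₀ I := by
    rw [map_sum, ← Equiv.sum_comp (flipAt_involutive i).toPerm]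
    simp [h.w_apply_spinorVec, flipAt_involutive i _]
  calc _ = ∑ I, spinorAct l m x y f I • spinorVec w x₀ I := by
        simp only [hw, hp, spinorAct, add_smul, Finset.sum_add_distrib, Finset.smul_sum,
          Finset.sum_smul, mul_smul, Finset.mul_sum]
        rw [Finset.sum_comm (f := fun i I ↦ m • _), Finset.sum_comm (f := fun i I ↦ x i • _),
          Finset.sum_comm (f := fun i I ↦ y i • _)]
    _ = 0 := by simp [H]

end Normalized

end QuaternionSystem
end System

section Normalization

theorem QuaternionSystem.map {R S A B : Type*} [CommRing R] [CommRing S] [Ring A] [Ring B]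
    [Algebra R A] [Algebra S B] {a b : Fin 4 → R} {u v : Fin 4 → A}
    (h : QuaternionSystem a b u v) (g : R → S) (f : A →+* B)
    (hfg : ∀ r, f (algebraMap R A r) = algebraMap S B (g r)) :
    QuaternionSystem (g ∘ a) (g ∘ b) (f ∘ u) (f ∘ v) where
  u_mul_u i := by simp [← map_mul, h.u_mul_u, hfg]
  v_mul_v i := by simp [← map_mul, h.v_mul_v, hfg]
  v_mul_u i := by
    rw [Function.comp_apply, Function.comp_apply, ← map_mul, h.v_mul_u, map_mul, map_sub, map_one]
  u_comm_u hij := by simp [← map_mul, h.u_comm_u hij]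
  u_comm_v hij := by simp [← map_mul, h.u_comm_v hij]
  v_comm_v hij := by simp [← map_mul, h.v_comm_v hij]

variable {K A : Type*} [Field K] [CharP K 2] [Ring A] [Algebra K A]

theorem add_self_eq_zero_of_charTwo_algebra (K : Type*) {A : Type*} [Field K] [CharP K 2]
    [AddCommGroup A] [Module K A] (x : A) : x + x = 0 := by
  rw [← two_smul K, CharTwo.two_eq_zero, zero_smul]

theorem QuaternionSystem.normalize {a b : Fin 4 → K} {u v : Fin 4 → A}
    (h : QuaternionSystem a b u v) {α β : Fin 4 → K} (hα : ∀ i, α i * α i + α i = a i)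
    (hβ : ∀ i, β i * β i = b i) (hb : ∀ i, b i ≠ 0) :
    QuaternionSystem (0 : Fin 4 → K) 1 (fun i ↦ u i + algebraMap K A (α i))
      (fun i ↦ (β i)⁻¹ • v i) where
  u_mul_u i := by
    have h1 := h.u_mul_u i
    have h2 : (2 : K) = 0 := CharTwo.two_eq_zero
    simp only [Algebra.algebraMap_eq_smul_one, mul_add, add_mul, smul_mul_assoc, mul_smul_comm,
      one_mul, mul_one, Pi.zero_apply] at h1 ⊢
    rw [← hα i] at h1
    linear_combination (norm := module) h1 + h2 • (α i • u i) + h2 • (α i * α i) • (1 : A)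
  v_mul_v i := by
    have hβi : β i ≠ 0 := by rintro h0; exact hb i (by rw [← hβ, h0, zero_mul])
    simp only [smul_mul_assoc, mul_smul_comm, h.v_mul_v, ← hβ, Algebra.algebraMap_eq_smul_one,
      smul_smul, Pi.one_apply]
    congr 1
    field_simp
  v_mul_u i := by
    have h1 := h.v_mul_u i
    have h2 : (2 : K) = 0 := CharTwo.two_eq_zero
    simp only [Algebra.algebraMap_eq_smul_one, mul_add, add_mul, smul_mul_assoc, mul_smul_comm,
      one_mul, mul_one, sub_mul] at h1 ⊢
    linear_combination (norm := module) (β i)⁻¹ • h1 + h2 • ((α i * (β i)⁻¹) • v i)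
  u_comm_u {i j} hij :=
    (((show Commute (u i) (u j) from h.u_comm_u hij).add_left
      (Algebra.commutes _ _)).add_right (Algebra.commutes _ _).symm).eq
  u_comm_v {i j} hij :=
    ((show Commute (u i) (v j) from h.u_comm_v hij).add_left
      (Algebra.commutes _ _)).smul_right _
  v_comm_v {i j} hij :=
    ((show Commute (v i) (v j) from h.v_comm_v hij).smul_left _).smul_right _

theorem QuaternionSystem.exists_relation_of_isAlgClosed [IsAlgClosed K] {W : Type*}
    [AddCommGroup W] [Module K W] {a b : Fin 4 → K} {u v : Fin 4 → Module.End K W}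
    (h : QuaternionSystem a b u v) (hb : ∀ i, b i ≠ 0) (hW : Module.finrank K W = 16) (s : W) :
    ∃ (l m : K) (x y : Fin 4 → K), (l ≠ 0 ∨ m ≠ 0 ∨ x ≠ 0 ∨ y ≠ 0) ∧
      l • s + m • ∑ i, u i s + ∑ i, x i • v i s + ∑ i, y i • u i (v i s) = 0 := by
  have hα (i : Fin 4) : ∃ α : K, α * α + α = a i := by
    obtain ⟨α, hα⟩ := IsAlgClosed.exists_root
      (Polynomial.X ^ 2 + Polynomial.X - Polynomial.C (a i)) (by
        have : (Polynomial.X ^ 2 + Polynomial.X - Polynomial.C (a i)).degree = 2 := by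
          compute_degree!
        simp [this])
    exact ⟨α, by simpa [sub_eq_zero, sq] using hα⟩
  have hβ (i : Fin 4) : ∃ β : K, β * β = b i :=
    (IsAlgClosed.exists_eq_mul_self (b i)).imp fun _ ↦ Eq.symm
  choose α hα using hα
  choose β hβ using hβ
  have hβ0 (i) : β i ≠ 0 := by intro h0; exact hb i (by rw [← hβ, h0, zero_mul])
  obtain ⟨l, m, x, y, hne, H⟩ := (h.normalize hα hβ hb).exists_relation hW s
  refine ⟨l + m * ∑ i, α i, m, fun i ↦ (β i)⁻¹ * (x i + y i * α i), fun i ↦ (β i)⁻¹ * y i,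
    ?_, ?_⟩
  · contrapose! hne
    obtain ⟨h1, rfl, h3, h4⟩ := hne
    obtain rfl : y = 0 := funext fun i ↦ by simpa [hβ0 i] using congrFun h4 i
    exact ⟨by simpa using h1, rfl, funext fun i ↦ by simpa [hβ0 i] using congrFun h3 i, rfl⟩
  · rw [← H]
    simp only [LinearMap.add_apply, LinearMap.smul_apply, Module.algebraMap_end_apply, map_smul,
      Fin.sum_univ_four]
    module

theorem QuaternionSystem.exists_relation_of_matrix {F : Type*} [Field F] [CharP F 2]
    {a b : Fin 4 → F} {u v : Fin 4 → Matrix (Fin 16) (Fin 16) F}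
    (h : QuaternionSystem a b u v) (hb : ∀ i, b i ≠ 0) (s : Fin 16 → F) :
    ∃ (l m : F) (x y : Fin 4 → F), (l ≠ 0 ∨ m ≠ 0 ∨ x ≠ 0 ∨ y ≠ 0) ∧
      (l • 1 + m • ∑ i, u i + ∑ i, (x i • v i + y i • (u i * v i))).mulVec s = 0 := by
  let K := AlgebraicClosure F
  have : CharP K 2 := charP_of_injective_algebraMap (algebraMap F K).injective 2
  let f : Matrix (Fin 16) (Fin 16) F →+* Module.End K (Fin 16 → K) :=
    (Matrix.toLinAlgEquiv' (R := K) (n := Fin 16)).toRingEquiv.toRingHom.comp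
      (algebraMap F K).mapMatrix
  have hf (M : Matrix (Fin 16) (Fin 16) F) (t : Fin 16 → F) :
      f M (algebraMap F K ∘ t) = algebraMap F K ∘ (M.mulVec t) := by
    ext i
    simpa [f] using (RingHom.map_mulVec (algebraMap F K) M t i).symm
  have hK := h.map (algebraMap F K) f fun r ↦ by
    ext i j
    simp [f, Matrix.algebraMap_eq_diagonal, Matrix.diagonal_map, Module.algebraMap_end_apply,
      Pi.single_apply]
  obtain ⟨l, m, x, y, hne, H⟩ := hK.exists_relation_of_isAlgClosed (by simpa using hb)
    (by simp) (algebraMap F K ∘ s)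
  let c : Fin 2 ⊕ Fin 4 ⊕ Fin 4 → Fin 16 → F :=
    Sum.elim ![s, (∑ i, u i).mulVec s]
      (Sum.elim (fun i ↦ (v i).mulVec s) fun i ↦ (u i * v i).mulVec s)
  have hc : ¬ LinearIndependent F c := by
    rw [← linearIndependent_algebraMap_comp_iff (S := K), Fintype.linearIndependent_iff]
    intro hc
    have h0 := hc (Sum.elim ![l, m] (Sum.elim x y)) (by
      rw [← H]
      simp only [Function.comp_apply, hf]
      simp only [c, Fintype.sum_sum_type, Sum.elim_inl, Sum.elim_inr, Fin.sum_univ_two,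
        Matrix.cons_val, ← hf, map_sum, LinearMap.sum_apply, ← Matrix.mulVec_mulVec, add_assoc])
    have hl := h0 (.inl 0)
    have hm := h0 (.inl 1)
    have hx : x = 0 := funext fun i ↦ h0 (.inr (.inl i))
    have hy : y = 0 := funext fun i ↦ h0 (.inr (.inr i))
    simp_all
  obtain ⟨g, hg, i, hi⟩ := Fintype.not_linearIndependent_iff.1 hc
  refine ⟨g (.inl 0), g (.inl 1), fun i ↦ g (.inr (.inl i)), fun i ↦ g (.inr (.inr i)), ?_, ?_⟩
  · contrapose! hi
    obtain ⟨h1, h2, h3, h4⟩ := hi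
    rcases i with i | i | i
    · fin_cases i <;> assumption
    · exact congrFun h3 i
    · exact congrFun h4 i
  · rw [← hg]
    simp only [c, Fintype.sum_sum_type, Sum.elim_inl, Sum.elim_inr, Fin.sum_univ_two,
      Matrix.cons_val, Matrix.add_mulVec, Matrix.smul_mulVec, Matrix.one_mulVec,
      Matrix.sum_mulVec, Finset.sum_add_distrib, add_assoc]

end Normalization

section Norm

variable {K A : Type*} [Field K] [CharP K 2] [Ring A] [Algebra K A]

theorem sum_mul_sum_self_of_commute {ι : Type*} (s : Finset ι) (z : ι → A)
    (hz : ∀ i j, i ≠ j → z i * z j = z j * z i) (hA : ∀ x : A, x + x = 0) :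
    (∑ i ∈ s, z i) * ∑ i ∈ s, z i = ∑ i ∈ s, z i * z i := by
  classical
  induction s using Finset.induction_on with
  | empty => simp
  | insert i s hi ih =>
    have : (∑ j ∈ s, z j) * z i = z i * ∑ j ∈ s, z j := by
      rw [Finset.sum_mul, Finset.mul_sum]
      exact Finset.sum_congr rfl fun j hj ↦ hz j i (by rintro rfl; exact hi hj)
    rw [Finset.sum_insert hi, Finset.sum_insert hi, mul_add, add_mul, add_mul, ih, this,
      add_assoc, ← add_assoc (z i * ∑ j ∈ s, z j), hA, zero_add]

/-- The conjugate of an element of the `10`-dimensional space times the element is its norm. -/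
theorem QuaternionSystem.conj_mul_self {a b : Fin 4 → K} {u v : Fin 4 → A}
    (h : QuaternionSystem a b u v) (l m : K) (x y : Fin 4 → K) :
    (l • 1 + m • (∑ i, u i + 1) + ∑ i, (x i • v i + y i • (u i * v i))) *
      (l • 1 + m • ∑ i, u i + ∑ i, (x i • v i + y i • (u i * v i))) =
    (l ^ 2 + l * m + m ^ 2 * ∑ i, a i +
      ∑ i, b i * (x i ^ 2 + x i * y i + a i * y i ^ 2)) • (1 : A) := by
  have hA (x : A) : x + x = 0 := add_self_eq_zero_of_charTwo_algebra K x
  have h2 : (2 : K) = 0 := CharTwo.two_eq_zero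
  set z : Fin 4 → A := fun i ↦ x i • v i + y i • (u i * v i) with hz
  have hu (i) : u i * u i = u i + a i • (1 : A) := by
    rw [h.u_mul_u, Algebra.algebraMap_eq_smul_one]
  have hv (i) : v i * v i = b i • (1 : A) := by
    rw [h.v_mul_v, Algebra.algebraMap_eq_smul_one]
  have hvu (i) : v i * u i = v i - u i * v i := by rw [h.v_mul_u, sub_mul, one_mul]
  have huz (i j) : u i * z j + z j * u i = if i = j then z i else 0 := by
    split_ifs with hij
    · subst hij
      simp only [hz, mul_add, add_mul, mul_smul_comm, smul_mul_assoc, mul_assoc, hvu, mul_sub]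
      module
    · have : u i * z j = z j * u i :=
        (((show Commute (u i) (v j) from h.u_comm_v hij).smul_right _).add_right
          (((show Commute (u i) (u j) from h.u_comm_u hij).mul_right
            (h.u_comm_v hij)).smul_right _)).eq
      rw [this, hA]
  have hzz (i) : z i * z i = (b i * (x i ^ 2 + x i * y i + a i * y i ^ 2)) • (1 : A) := by
    have h1 : v i * (u i * v i) = b i • (1 - u i) := by
      rw [← mul_assoc, h.v_mul_u, mul_assoc, hv, mul_smul_comm, mul_one]
    have h3 : u i * v i * v i = b i • u i := by rw [mul_assoc, hv, mul_smul_comm, mul_one]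
    have h4 : u i * v i * (u i * v i) = - (b i * a i) • (1 : A) := by
      rw [mul_assoc, h1, mul_smul_comm, mul_sub, mul_one, hu]; module
    simp only [hz, mul_add, add_mul, mul_smul_comm, smul_mul_assoc, hv, h1, h3, h4]
    linear_combination (norm := module) - h2 • (b i * a i * y i ^ 2) • (1 : A)
  have hZ : (∑ i, z i) * ∑ i, z i =
      (∑ i, b i * (x i ^ 2 + x i * y i + a i * y i ^ 2)) • (1 : A) := by
    rw [sum_mul_sum_self_of_commute _ _ _ hA, Finset.sum_smul]
    · exact Finset.sum_congr rfl fun i _ ↦ hzz i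
    · intro i j hij
      have hvv : Commute (v i) (v j) := h.v_comm_v hij
      have huu : Commute (u i) (u j) := h.u_comm_u hij
      have huv : Commute (u i) (v j) := h.u_comm_v hij
      have hvu : Commute (v i) (u j) := (h.u_comm_v hij.symm).symm
      exact (((hvv.smul_left _).smul_right _ |>.add_right
        ((hvu.mul_right hvv).smul_left _ |>.smul_right _)).add_left
        (((huv.mul_left hvv).smul_left _).smul_right _ |>.add_right
        (((huu.mul_left hvu).mul_right (huv.mul_left hvv)).smul_left _ |>.smul_right _))).eq
  have hU : (∑ i, u i) * ∑ i, u i = ∑ i, u i + (∑ i, a i) • (1 : A) := by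
    rw [sum_mul_sum_self_of_commute _ _ (fun _ _ hij ↦ h.u_comm_u hij) hA, Finset.sum_smul,
      ← Finset.sum_add_distrib]
    exact Finset.sum_congr rfl fun i _ ↦ hu i
  have hUZ : (∑ i, u i) * ∑ i, z i + (∑ i, z i) * ∑ i, u i = ∑ i, z i := by
    rw [Finset.sum_mul_sum, Finset.sum_mul_sum, Finset.sum_comm (f := fun i j ↦ z i * u j),
      ← Finset.sum_add_distrib]
    simp [← Finset.sum_add_distrib, huz]
  generalize ∑ i, u i = U at *
  generalize ∑ i, z i = Z at *
  generalize ∑ i, b i * (x i ^ 2 + x i * y i + a i * y i ^ 2) = q at *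
  simp only [mul_add, add_mul, mul_smul_comm, smul_mul_assoc, one_mul, mul_one, smul_add]
  linear_combination (norm := module) m ^ 2 • hU + m • hUZ + hZ + h2 • ((l * m) • U) +
    h2 • (l • Z) + h2 • (m • Z) + h2 • (m ^ 2 • U)

end Norm

section Main

variable {F : Type*} [Field F]

theorem exists_affine_zero_of_isotropic [CharP F 2] {a b : Fin 4 → F} (hb : ∀ i, b i ≠ 0) {l m : F}
    {x y : Fin 4 → F} (hne : l ≠ 0 ∨ m ≠ 0 ∨ x ≠ 0 ∨ y ≠ 0)
    (h : l ^ 2 + l * m + m ^ 2 * ∑ i, a i +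
      ∑ i, b i * (x i ^ 2 + x i * y i + a i * y i ^ 2) = 0) :
    ∃ (l : F) (x y : Fin 4 → F), l ^ 2 + l + ∑ i, a i +
      ∑ i, b i * (x i ^ 2 + x i * y i + a i * y i ^ 2) = 0 := by
  have h2 : (2 : F) = 0 := CharTwo.two_eq_zero
  by_cases hm : m = 0
  · subst hm
    obtain ⟨x', y', hxy⟩ : ∃ x' y' : Fin 4 → F, l + ∑ i, b i * (x i * y' i + x' i * y i) ≠ 0 := by
      by_contra! H
      have hl : l = 0 := by simpa using H 0 0
      have hx : x = 0 := funext fun i ↦ by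
        simpa [hl, Pi.single_apply, hb] using H 0 (Pi.single i 1)
      have hy : y = 0 := funext fun i ↦ by
        simpa [hl, Pi.single_apply, hb] using H (Pi.single i 1) 0
      simp_all
    set c := l + ∑ i, b i * (x i * y' i + x' i * y i) with hc
    set q := ∑ i, a i + ∑ i, b i * (x' i ^ 2 + x' i * y' i + a i * y' i ^ 2) with hq
    refine ⟨q / c * l, fun i ↦ x' i + q / c * x i, fun i ↦ y' i + q / c * y i, ?_⟩
    clear_value c q
    have hk : q / c * c = q := div_mul_cancel₀ _ hxy
    generalize q / c = k at *
    simp only [Fin.sum_univ_four] at *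
    linear_combination k ^ 2 * h + hk - k * hc - hq + h2 * (q +
      k * (b 0 * a 0 * y' 0 * y 0 + b 1 * a 1 * y' 1 * y 1 + b 2 * a 2 * y' 2 * y 2 +
        b 3 * a 3 * y' 3 * y 3 + b 0 * x' 0 * x 0 + b 1 * x' 1 * x 1 + b 2 * x' 2 * x 2 +
        b 3 * x' 3 * x 3))
  · refine ⟨l / m, fun i ↦ x i / m, fun i ↦ y i / m, ?_⟩
    simp only [Fin.sum_univ_four] at *
    field_simp
    linear_combination h

theorem QuaternionSystem.exists_affine_zero [CharP F 2] {a b : Fin 4 → F}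
    {u v : Fin 4 → Matrix (Fin 16) (Fin 16) F}
    (h : QuaternionSystem a b u v) (hb : ∀ i, b i ≠ 0) :
    ∃ (l : F) (x y : Fin 4 → F), l ^ 2 + l + ∑ i, a i +
      ∑ i, b i * (x i ^ 2 + x i * y i + a i * y i ^ 2) = 0 := by
  obtain ⟨l, m, x, y, hne, H⟩ := h.exists_relation_of_matrix hb 1
  refine exists_affine_zero_of_isotropic hb hne ?_
  have := congrArg (Matrix.mulVec (l • 1 + m • (∑ i, u i + 1) +
    ∑ i, (x i • v i + y i • (u i * v i)))) H
  rw [Matrix.mulVec_mulVec, h.conj_mul_self, Matrix.mulVec_zero, Matrix.smul_mulVec,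
    Matrix.one_mulVec] at this
  simpa using congrFun this 0

open Algebra.TensorProduct in
theorem exists_commuting_algHoms {R Q₁ Q₂ Q₃ Q₄ B : Type*} [CommRing R] [Ring Q₁] [Ring Q₂]
    [Ring Q₃] [Ring Q₄] [Ring B] [Algebra R Q₁] [Algebra R Q₂] [Algebra R Q₃] [Algebra R Q₄]
    [Algebra R B] (e : ((Q₁ ⊗[R] Q₂) ⊗[R] Q₃) ⊗[R] Q₄ →ₐ[R] B) :
    ∃ (f₁ : Q₁ →ₐ[R] B) (f₂ : Q₂ →ₐ[R] B) (f₃ : Q₃ →ₐ[R] B) (f₄ : Q₄ →ₐ[R] B),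
      (∀ x y, Commute (f₁ x) (f₂ y)) ∧ (∀ x y, Commute (f₁ x) (f₃ y)) ∧
      (∀ x y, Commute (f₁ x) (f₄ y)) ∧ (∀ x y, Commute (f₂ x) (f₃ y)) ∧
      (∀ x y, Commute (f₂ x) (f₄ y)) ∧ (∀ x y, Commute (f₃ x) (f₄ y)) := by
  refine ⟨e.comp (includeLeft.comp (includeLeft.comp includeLeft)),
    e.comp (includeLeft.comp (includeLeft.comp includeRight)),
    e.comp (includeLeft.comp includeRight), e.comp includeRight, ?_, ?_, ?_, ?_, ?_, ?_⟩ <;>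
  · intro x y
    simp [Commute, SemiconjBy, ← map_mul]

namespace QuatAlg

variable (a b : F)

def u : QuatAlg F a b := RingQuot.mkAlgHom F (QuatRel F a b) (FreeAlgebra.ι F 0)

def v : QuatAlg F a b := RingQuot.mkAlgHom F (QuatRel F a b) (FreeAlgebra.ι F 1)

theorem u_mul_u : u a b * u a b = u a b + algebraMap F _ a := by
  have h := RingQuot.mkAlgHom_rel F (QuatRel.u_sq (F := F) (a := a) (b := b))
  rw [map_sub, map_mul, AlgHom.commutes] at h
  exact sub_eq_iff_eq_add'.1 h

theorem v_mul_v : v a b * v a b = algebraMap F _ b := by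
  have h := RingQuot.mkAlgHom_rel F (QuatRel.v_sq (F := F) (a := a) (b := b))
  rw [map_mul, AlgHom.commutes] at h
  exact h

theorem v_mul_u : v a b * u a b = (1 - u a b) * v a b := by
  have h := RingQuot.mkAlgHom_rel F (QuatRel.vu (F := F) (a := a) (b := b))
  rw [map_mul, map_mul, map_sub, map_one] at h
  exact h

end QuatAlg

theorem exists_quaternionSystem {a₁ a₂ a₃ a₄ b₁ b₂ b₃ b₄ : F} {B : Type*} [Ring B] [Algebra F B]
    (e : ((QuatAlg F a₁ b₁ ⊗[F] QuatAlg F a₂ b₂) ⊗[F] QuatAlg F a₃ b₃) ⊗[F]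
      QuatAlg F a₄ b₄ →ₐ[F] B) :
    ∃ u v : Fin 4 → B, QuaternionSystem ![a₁, a₂, a₃, a₄] ![b₁, b₂, b₃, b₄] u v := by
  obtain ⟨f₁, f₂, f₃, f₄, h₁₂, h₁₃, h₁₄, h₂₃, h₂₄, h₃₄⟩ := exists_commuting_algHoms e
  refine ⟨![f₁ (.u _ _), f₂ (.u _ _), f₃ (.u _ _), f₄ (.u _ _)],
    ![f₁ (.v _ _), f₂ (.v _ _), f₃ (.v _ _), f₄ (.v _ _)], ?_, ?_, ?_, ?_, ?_, ?_⟩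
  · intro i; fin_cases i <;> simp [← map_mul, QuatAlg.u_mul_u]
  · intro i; fin_cases i <;> simp [← map_mul, QuatAlg.v_mul_v]
  · intro i
    fin_cases i <;> simp only [Fin.zero_eta, Fin.mk_one, Fin.reduceFinMk, Matrix.cons_val,
      ← map_mul, QuatAlg.v_mul_u] <;> simp only [map_mul, map_sub, map_one]
  all_goals
    intro i j hij
    fin_cases i <;> fin_cases j <;> first
      | exact absurd rfl hij
      | exact h₁₂ _ _ | exact h₁₃ _ _ | exact h₁₄ _ _ | exact h₂₃ _ _ | exact h₂₄ _ _
      | exact h₃₄ _ _ | exact (h₁₂ _ _).symm | exact (h₁₃ _ _).symm | exact (h₁₄ _ _).symm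
      | exact (h₂₃ _ _).symm | exact (h₂₄ _ _).symm | exact (h₃₄ _ _).symm

end Main

set_option maxSynthPendingDepth 3 in
set_option maxHeartbeats 1000000 in

theorem stmt3 (F : Type*) [Field F] [CharP F 2] (a₁ a₂ a₃ a₄ : F) (b₁ b₂ b₃ b₄ : F)
    (hb₁ : b₁ ≠ 0) (hb₂ : b₂ ≠ 0) (hb₃ : b₃ ≠ 0) (hb₄ : b₄ ≠ 0)
    (hsplit : Nonempty
      ((((QuatAlg F a₁ b₁ ⊗[F] QuatAlg F a₂ b₂) ⊗[F] QuatAlg F a₃ b₃) ⊗[F]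
          QuatAlg F a₄ b₄) ≃ₐ[F] Matrix (Fin 16) (Fin 16) F)) :
    ∃ l x₁ y₁ x₂ y₂ x₃ y₃ x₄ y₄ : F,
      l ^ 2 + l + a₁ + a₂ + a₃ + a₄ +
          (b₁ * (x₁ ^ 2 + x₁ * y₁ + a₁ * y₁ ^ 2) +
            b₂ * (x₂ ^ 2 + x₂ * y₂ + a₂ * y₂ ^ 2) +
            b₃ * (x₃ ^ 2 + x₃ * y₃ + a₃ * y₃ ^ 2) +
            b₄ * (x₄ ^ 2 + x₄ * y₄ + a₄ * y₄ ^ 2)) = 0 := by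
  obtain ⟨e⟩ := hsplit
  obtain ⟨u, v, h⟩ := exists_quaternionSystem e.toAlgHom
  obtain ⟨l, x, y, hl⟩ := h.exists_affine_zero (by intro i; fin_cases i <;> assumption)
  refine ⟨l, x 0, y 0, x 1, y 1, x 2, y 2, x 3, y 3, ?_⟩
  simp only [Fin.sum_univ_four, Matrix.cons_val] at hl
  linear_combination hl
end

section
/- Let F be a field of characteristic 2, let c₁, c₂, c₃ ∈ F and d₁, d₂, d₃, d₄ ∈ Fˣ. If the tensor product [c₁,d₁)_F ⊗_F [c₂,d₂)_F ⊗_F [c₃,d₃)_F ⊗_F [c₁+c₂+c₃,d₄)_F is split (isomorphic as an F-algebra to the algebra of 16×16 matrices over F), then the tensor product [c₁,d₁d₄)_F ⊗_F [c₂,d₂d₄)_F ⊗_F [c₃,d₃d₄)_F is split (isomorphic as an F-algebra to the algebra of 8×8 matrices over F). -/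
open scoped TensorProduct

open QuaternionAlgebra in
/-- `QuatAlg F a b` is Mathlib's quaternion algebra `ℍ[F, a, 1, b]`. -/
noncomputable def QuatAlg.equivQuaternionAlgebra (F : Type*) [Field F] (a b : F) :
    QuatAlg F a b ≃ₐ[F] QuaternionAlgebra F a 1 b :=
  let q : Basis (RingQuot (QuatRel F a b)) a 1 b :=
    { i := RingQuot.mkAlgHom F _ (FreeAlgebra.ι F 0)
      j := RingQuot.mkAlgHom F _ (FreeAlgebra.ι F 1)
      k := RingQuot.mkAlgHom F _ (FreeAlgebra.ι F 0 * FreeAlgebra.ι F 1)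
      i_mul_i := by
        have h := RingQuot.mkAlgHom_rel F (QuatRel.u_sq (F := F) (a := a) (b := b))
        rw [map_sub, map_mul, AlgHom.commutes, sub_eq_iff_eq_add] at h
        rw [h, one_smul, Algebra.algebraMap_eq_smul_one]
      j_mul_j := by
        have h := RingQuot.mkAlgHom_rel F (QuatRel.v_sq (F := F) (a := a) (b := b))
        rw [map_mul, AlgHom.commutes] at h
        rw [h, Algebra.algebraMap_eq_smul_one]
      i_mul_j := (map_mul _ _ _).symm
      j_mul_i := by
        have h := RingQuot.mkAlgHom_rel F (QuatRel.vu (F := F) (a := a) (b := b))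
        rw [map_mul] at h
        rw [h, sub_mul, one_mul, map_sub, one_smul] }
  let f : RingQuot (QuatRel F a b) →ₐ[F] QuaternionAlgebra F a 1 b :=
    RingQuot.liftAlgHom F ⟨FreeAlgebra.lift F ![(Basis.self F).i, (Basis.self F).j], by
      rintro _ _ (_ | _ | _) <;> ext <;> simp⟩
  let E : RingQuot (QuatRel F a b) ≃ₐ[F] QuaternionAlgebra F a 1 b :=
    AlgEquiv.ofAlgHom f q.liftHom
      (by ext <;> simp [f, q, Basis.lift])
      (by
        apply RingQuot.ringQuot_ext'
        ext x
        fin_cases x <;> simp [f, q, Basis.lift])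
  E

namespace QuaternionAlgebra.Basis

variable {F A : Type*} [Field F] [Ring A] [Algebra F A]

theorem commute_lift {a b c : F} (q : Basis A a b c) {x : A} (hi : Commute x q.i)
    (hj : Commute x q.j) (y : QuaternionAlgebra F a b c) : Commute x (q.lift y) := by
  have hk : Commute x q.k := q.i_mul_j ▸ hi.mul_right hj
  have h1 : Commute x (algebraMap F A y.re) := (Algebra.commutes _ _).symm
  exact ((h1.add_right (hi.smul_right _)).add_right (hj.smul_right _)).add_right
    (hk.smul_right _)

theorem commute_lift_lift {a b c a' b' c' : F} (p : Basis A a b c) (q : Basis A a' b' c')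
    (hii : Commute p.i q.i) (hij : Commute p.i q.j) (hji : Commute p.j q.i)
    (hjj : Commute p.j q.j) (x : QuaternionAlgebra F a b c) (y : QuaternionAlgebra F a' b' c') :
    Commute (p.lift x) (q.lift y) :=
  q.commute_lift (p.commute_lift hii.symm hji.symm x).symm
    (p.commute_lift hij.symm hjj.symm x).symm y

/-- If `u, v` generate `[a, b * e)`, then `diag(u, u)` and `v * w / e` generate `[a, b)`, where
`w` is the standard matrix with `w ^ 2 = e`. -/
def twist {a b e : F} (he : e ≠ 0) (q : Basis A a 1 (b * e)) :
    Basis (Matrix (Fin 2) (Fin 2) A) a 1 b where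
  i := !![q.i, 0; 0, q.i]
  j := !![0, q.j; e⁻¹ • q.j, 0]
  k := !![0, q.k; e⁻¹ • q.k, 0]
  i_mul_i := by
    ext i j; fin_cases i <;> fin_cases j <;> simp [Matrix.mul_apply]
  j_mul_j := by
    have h : e⁻¹ * (b * e) = b := by field_simp
    ext i j; fin_cases i <;> fin_cases j <;> simp [Matrix.mul_apply, smul_smul, h]
  i_mul_j := by
    ext i j; fin_cases i <;> fin_cases j <;> simp [Matrix.mul_apply]
  j_mul_i := by
    ext i j; fin_cases i <;> fin_cases j <;> simp [Matrix.mul_apply, smul_sub]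

/-- An element `s` with `s ^ 2 = s + a` yields a quaternion algebra `[a, e)` inside the
`2 × 2` matrices, with generators `diag(s + 1, s)` and the standard matrix squaring to `e`. -/
def ofRoot [CharP A 2] {a : F} (e : F) {s : A} (hs : s * s = a • (1 : A) + s) :
    Basis (Matrix (Fin 2) (Fin 2) A) a 1 e where
  i := !![s + 1, 0; 0, s]
  j := !![0, e • (1 : A); 1, 0]
  k := !![0, e • (s + 1); s, 0]
  i_mul_i := by
    have h : (s + 1) * (s + 1) = a • 1 + (s + 1) := by
      rw [mul_add, add_mul, hs, one_mul, mul_one, add_assoc, CharTwo.add_cancel_left, add_assoc]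
    ext i j; fin_cases i <;> fin_cases j <;> simp [Matrix.mul_apply, hs, h]
  j_mul_j := by
    ext i j; fin_cases i <;> fin_cases j <;> simp [Matrix.mul_apply]
  i_mul_j := by
    ext i j; fin_cases i <;> fin_cases j <;> simp [Matrix.mul_apply]
  j_mul_i := by
    have h : s = 1 + (s + 1) := by rw [add_comm s, CharTwo.add_cancel_left]
    ext i j; fin_cases i <;> fin_cases j <;>
      simp [Matrix.mul_apply, CharTwo.sub_eq_add, add_comm]
    rw [← smul_add, ← smul_add, ← h]

theorem commute_twist_twist {a a' b b' e : F} (he : e ≠ 0) (p : Basis A a 1 (b * e))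
    (q : Basis A a' 1 (b' * e)) (h : ∀ x y, Commute (p.lift x) (q.lift y))
    (x : QuaternionAlgebra F a 1 b) (y : QuaternionAlgebra F a' 1 b') :
    Commute ((p.twist he).lift x) ((q.twist he).lift y) := by
  have hii : Commute p.i q.i := by simpa [lift] using h (Basis.self F).i (Basis.self F).i
  have hij : Commute p.i q.j := by simpa [lift] using h (Basis.self F).i (Basis.self F).j
  have hji : Commute p.j q.i := by simpa [lift] using h (Basis.self F).j (Basis.self F).i
  have hjj : Commute p.j q.j := by simpa [lift] using h (Basis.self F).j (Basis.self F).j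
  apply commute_lift_lift <;> ext i j <;> fin_cases i <;> fin_cases j <;>
    simp [twist, Matrix.mul_apply, hii.eq, hij.eq, hji.eq, hjj.eq]

theorem commute_twist_ofRoot [CharP A 2] {a a' b e : F} (he : e ≠ 0) (q : Basis A a 1 (b * e))
    {s : A} (hs : s * s = a' • (1 : A) + s) (hi : Commute q.i s) (hj : q.j * s = (s + 1) * q.j)
    (x : QuaternionAlgebra F a 1 b) (y : QuaternionAlgebra F a' 1 e) :
    Commute ((q.twist he).lift x) ((ofRoot e hs).lift y) := by
  have hj' : q.j * (s + 1) = s * q.j := by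
    rw [mul_add, hj, add_mul, one_mul, mul_one, add_assoc, CharTwo.add_self_eq_zero, add_zero]
  have hi' := hi.add_right (Commute.one_right q.i)
  apply commute_lift_lift <;> ext i j <;> fin_cases i <;> fin_cases j <;>
    simp [twist, ofRoot, Matrix.mul_apply, smul_smul, he, hi.eq, hj, hi'.eq, hj']

end QuaternionAlgebra.Basis

theorem Algebra.TensorProduct.commute_includeLeft_includeRight {F A B : Type*} [Field F] [Ring A]
    [Algebra F A] [Ring B] [Algebra F B] (x : A) (y : B) :
    Commute (includeLeft (R := F) (S := F) (B := B) x) (includeRight (R := F) (A := A) y) := by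
  simp [Commute, SemiconjBy]

theorem Algebra.TensorProduct.commute_lift {F A B C : Type*} [Field F] [Ring A] [Algebra F A]
    [Ring B] [Algebra F B] [Ring C] [Algebra F C] {f : A →ₐ[F] C} {g : B →ₐ[F] C}
    (hfg : ∀ x y, Commute (f x) (g y)) {c : C} (hf : ∀ x, Commute (f x) c)
    (hg : ∀ y, Commute (g y) c) (z : A ⊗[F] B) : Commute (lift f g hfg z) c := by
  induction z with
  | zero => simp
  | tmul x y => simpa using (hf x).mul_left (hg y)
  | add x y hx hy => simpa using hx.add_left hy

section

open Module

variable {F A : Type*} [Field F] [Ring A] [Algebra F A]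

/-- If `M₂(A)` is split then so is `A`: it acts faithfully on the image of a corner idempotent. -/
theorem nonempty_algEquiv_matrix_of_matrix_two (n : ℕ) (hA : finrank F A = n * n) (hn : n ≠ 0)
    (φ : Matrix (Fin 2) (Fin 2) A ≃ₐ[F] Matrix (Fin (2 * n)) (Fin (2 * n)) F) :
    Nonempty (A ≃ₐ[F] Matrix (Fin n) (Fin n) F) := by
  have : FiniteDimensional F A := FiniteDimensional.of_finrank_pos (by rw [hA]; positivity)
  let Φ : Matrix (Fin 2) (Fin 2) A ≃ₐ[F] End F (Fin (2 * n) → F) := φ.trans Matrix.toLinAlgEquiv'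
  let e := Φ !![1, 0; 0, 0]
  let s := Φ !![0, 1; 1, 0]
  have he : IsIdempotentElem e := by
    rw [IsIdempotentElem, ← map_mul, Matrix.mul_fin_two]; simp [e]
  have hs : s * s = 1 := by
    rw [← map_mul, ← map_one Φ, Matrix.mul_fin_two]; simp [Matrix.one_fin_two]
  have hse : s * e = (1 - e) * s := by
    rw [← map_one Φ, ← map_sub Φ, ← map_mul Φ, ← map_mul Φ, Matrix.one_fin_two]
    refine congrArg Φ ?_
    ext i j; fin_cases i <;> fin_cases j <;> simp [Matrix.mul_apply]
  have hsinj : Function.Injective s :=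
    Function.LeftInverse.injective (g := s) (LinearMap.congr_fun hs)
  have hker : LinearMap.ker e = (LinearMap.range e).map s := by
    rw [LinearMap.IsIdempotentElem.ker_eq_range_one_sub he, ← LinearMap.range_comp,
      ← Module.End.mul_eq_comp, hse, Module.End.mul_eq_comp, LinearMap.range_comp,
      LinearMap.range_eq_top.2 (LinearMap.injective_iff_surjective.1 hsinj), Submodule.map_top]
  have hW : finrank F (LinearMap.range e) = n := by
    have h := LinearMap.finrank_range_add_finrank_ker e
    rw [hker, ← (Submodule.equivMapOfInjective s hsinj _).finrank_eq, finrank_fin_fun] at h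
    omega
  let δ : A →ₐ[F] End F (Fin (2 * n) → F) :=
    Φ.toAlgHom.comp (Matrix.scalarAlgHom (Fin 2) F)
  have hδe (a : A) : δ a * e = Φ !![a, 0; 0, 0] := by
    refine (map_mul Φ _ _).symm.trans (congrArg Φ ?_)
    ext i j; fin_cases i <;> fin_cases j <;> simp
  have heδ (a : A) : e * δ a = Φ !![a, 0; 0, 0] := by
    refine (map_mul Φ _ _).symm.trans (congrArg Φ ?_)
    ext i j; fin_cases i <;> fin_cases j <;> simp
  have hcomm (a : A) : ∀ w ∈ LinearMap.range e, δ a w ∈ LinearMap.range e := by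
    rintro _ ⟨w, rfl⟩
    exact ⟨δ a w, LinearMap.congr_fun ((heδ a).trans (hδe a).symm) w⟩
  let ρ : A →ₐ[F] End F (LinearMap.range e) := AlgHom.ofLinearMap
    { toFun a := (δ a).restrict (hcomm a)
      map_add' a b := by ext w : 2; simp
      map_smul' r a := by ext w : 2; simp }
    (by ext w : 2; simp) (fun a b ↦ by ext w : 2; simp)
  have hρ : Function.Injective ρ := by
    refine (injective_iff_map_eq_zero ρ).2 fun a ha ↦ ?_
    have h : Φ !![a, 0; 0, 0] = 0 := by
      rw [← hδe]
      exact LinearMap.ext fun w ↦ congrArg Subtype.val (LinearMap.congr_fun ha ⟨e w, w, rfl⟩)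
    rw [map_eq_zero_iff Φ Φ.injective] at h
    exact congrFun (congrFun h 0) 0
  let ε := algEquivMatrix (finBasisOfFinrankEq F _ hW)
  let σ : A →ₐ[F] Matrix (Fin n) (Fin n) F := ε.toAlgHom.comp ρ
  have hinj : Function.Injective σ := ε.injective.comp hρ
  have hdim : finrank F A = finrank F (Matrix (Fin n) (Fin n) F) := by
    simp [finrank_matrix, hA]
  have hsurj : Function.Surjective σ.toLinearMap :=
    (LinearMap.injective_iff_surjective_of_finrank_eq_finrank hdim).1 hinj
  exact ⟨AlgEquiv.ofBijective σ ⟨hinj, hsurj⟩⟩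

/-- A homomorphism from a matrix algebra into `M₂(A)` of the same dimension is an isomorphism, so
it splits `A`. -/
theorem nonempty_algEquiv_matrix_of_algHom (n : ℕ) (hA : finrank F A = n * n) (hn : n ≠ 0)
    (ψ : Matrix (Fin (2 * n)) (Fin (2 * n)) F →ₐ[F] Matrix (Fin 2) (Fin 2) A) :
    Nonempty (A ≃ₐ[F] Matrix (Fin n) (Fin n) F) := by
  have : FiniteDimensional F A := FiniteDimensional.of_finrank_pos (by rw [hA]; positivity)
  have : Nontrivial A := nontrivial_of_finrank_pos (R := F) (by rw [hA]; positivity)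
  have : NeZero n := ⟨hn⟩
  have hinj : Function.Injective ψ := ψ.toRingHom.injective
  have hdim : finrank F (Matrix (Fin (2 * n)) (Fin (2 * n)) F) =
      finrank F (Matrix (Fin 2) (Fin 2) A) := by
    simp only [finrank_matrix, Fintype.card_fin, hA, finrank_self]; ring
  have hsurj : Function.Surjective ψ.toLinearMap :=
    (LinearMap.injective_iff_surjective_of_finrank_eq_finrank hdim).1 hinj
  exact nonempty_algEquiv_matrix_of_matrix_two n hA hn (AlgEquiv.ofBijective ψ ⟨hinj, hsurj⟩).symm

set_option maxSynthPendingDepth 3 in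
open QuaternionAlgebra Basis in
/-- Three pairwise commuting quaternion bases of types `[cᵢ, dᵢ * e)` in `A` yield a homomorphism
`[c₁, d₁) ⊗ [c₂, d₂) ⊗ [c₃, d₃) ⊗ [c₁ + c₂ + c₃, e) → M₂(A)`. -/
theorem nonempty_algHom_matrix_two [CharP A 2] {c₁ c₂ c₃ d₁ d₂ d₃ e : F} (he : e ≠ 0)
    (q₁ : Basis A c₁ 1 (d₁ * e)) (q₂ : Basis A c₂ 1 (d₂ * e)) (q₃ : Basis A c₃ 1 (d₃ * e))
    (h₁₂ : ∀ x y, Commute (q₁.lift x) (q₂.lift y)) (h₁₃ : ∀ x y, Commute (q₁.lift x) (q₃.lift y))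
    (h₂₃ : ∀ x y, Commute (q₂.lift x) (q₃.lift y)) :
    Nonempty ((((QuaternionAlgebra F c₁ 1 d₁ ⊗[F] QuaternionAlgebra F c₂ 1 d₂) ⊗[F]
      QuaternionAlgebra F c₃ 1 d₃) ⊗[F] QuaternionAlgebra F (c₁ + c₂ + c₃) 1 e) →ₐ[F]
        Matrix (Fin 2) (Fin 2) A) := by
  have comm {a b a' b' : F} {p : Basis A a 1 b} {q : Basis A a' 1 b'}
      (h : ∀ x y, Commute (p.lift x) (q.lift y)) :
      Commute p.i q.i ∧ Commute p.i q.j ∧ Commute p.j q.i := by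
    refine ⟨?_, ?_, ?_⟩
    · simpa [Basis.lift] using h (Basis.self F).i (Basis.self F).i
    · simpa [Basis.lift] using h (Basis.self F).i (Basis.self F).j
    · simpa [Basis.lift] using h (Basis.self F).j (Basis.self F).i
  have shift {a b : F} (q : Basis A a 1 b) : q.j * q.i = (q.i + 1) * q.j := by
    rw [j_mul_i, add_mul, i_mul_j, one_mul, one_smul, CharTwo.sub_eq_add, add_comm]
  obtain ⟨ii₁₂, ij₁₂, ji₁₂⟩ := comm h₁₂
  obtain ⟨ii₁₃, ij₁₃, ji₁₃⟩ := comm h₁₃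
  obtain ⟨ii₂₃, ij₂₃, ji₂₃⟩ := comm h₂₃
  have hs : (q₁.i + q₂.i + q₃.i) * (q₁.i + q₂.i + q₃.i) =
      (c₁ + c₂ + c₃) • (1 : A) + (q₁.i + q₂.i + q₃.i) := by
    simp only [mul_add, add_mul, i_mul_i, one_smul, ii₁₂.eq, ii₁₃.eq, ii₂₃.eq, add_smul]
    have h (x : A) : x + x = 0 := CharTwo.add_self_eq_zero x
    linear_combination (norm := abel) h (q₂.i * q₁.i) + h (q₃.i * q₁.i) + h (q₃.i * q₂.i)
  have h₁ := commute_twist_ofRoot he q₁ hs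
    (((Commute.refl _).add_right ii₁₂).add_right ii₁₃)
    (by simp only [mul_add, shift, ji₁₂.eq, ji₁₃.eq, add_mul]; abel)
  have h₂ := commute_twist_ofRoot he q₂ hs
    ((ii₁₂.symm.add_right (Commute.refl _)).add_right ii₂₃)
    (by simp only [mul_add, shift, ij₁₂.eq, ji₂₃.eq, add_mul]; abel)
  have h₃ := commute_twist_ofRoot he q₃ hs
    ((ii₁₃.symm.add_right ii₂₃.symm).add_right (Commute.refl _))
    (by simp only [mul_add, shift, ij₁₃.eq, ij₂₃.eq, add_mul]; abel)
  have t₁₂ := commute_twist_twist he q₁ q₂ h₁₂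
  have t₁₃ := commute_twist_twist he q₁ q₃ h₁₃
  have t₂₃ := commute_twist_twist he q₂ q₃ h₂₃
  have t : ∀ x y, Commute (Algebra.TensorProduct.lift (q₁.twist he).liftHom
      (q₂.twist he).liftHom t₁₂ x) ((q₃.twist he).liftHom y) := fun x y ↦
    Algebra.TensorProduct.commute_lift _ (fun x ↦ t₁₃ x y) (fun x ↦ t₂₃ x y) x
  exact ⟨Algebra.TensorProduct.lift (Algebra.TensorProduct.lift _ _ t) (ofRoot e hs).liftHom
    fun x y ↦ Algebra.TensorProduct.commute_lift _
      (Algebra.TensorProduct.commute_lift _ (fun x ↦ h₁ x y) fun x ↦ h₂ x y) (fun x ↦ h₃ x y) x⟩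

end

set_option maxSynthPendingDepth 3 in
set_option maxHeartbeats 1000000 in

theorem stmt4 (F : Type*) [Field F] [CharP F 2] (c₁ c₂ c₃ : F) (d₁ d₂ d₃ d₄ : F)
    (hd₁ : d₁ ≠ 0) (hd₂ : d₂ ≠ 0) (hd₃ : d₃ ≠ 0) (hd₄ : d₄ ≠ 0)
    (hsplit : Nonempty
      ((((QuatAlg F c₁ d₁ ⊗[F] QuatAlg F c₂ d₂) ⊗[F] QuatAlg F c₃ d₃) ⊗[F]
          QuatAlg F (c₁ + c₂ + c₃) d₄) ≃ₐ[F] Matrix (Fin 16) (Fin 16) F)) :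
    Nonempty
      (((QuatAlg F c₁ (d₁ * d₄) ⊗[F] QuatAlg F c₂ (d₂ * d₄)) ⊗[F]
          QuatAlg F c₃ (d₃ * d₄)) ≃ₐ[F] Matrix (Fin 8) (Fin 8) F) := by
  obtain ⟨φ⟩ := hsplit
  let H (a b : F) := QuaternionAlgebra F a 1 b
  let E (a b : F) : QuatAlg F a b ≃ₐ[F] H a b := QuatAlg.equivQuaternionAlgebra F a b
  let A := (H c₁ (d₁ * d₄) ⊗[F] H c₂ (d₂ * d₄)) ⊗[F] H c₃ (d₃ * d₄)
  have hA : Module.finrank F A = 8 * 8 := by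
    simp [A, H, Module.finrank_tensorProduct, QuaternionAlgebra.finrank_eq_four]
  have : Nontrivial A := Module.nontrivial_of_finrank_pos (R := F) (by rw [hA]; positivity)
  have : CharP A 2 := charP_of_injective_algebraMap (algebraMap F A).injective 2
  let q (a b : F) : QuaternionAlgebra.Basis (H a b) a 1 b := QuaternionAlgebra.Basis.self F
  have hq {a b : F} (x : H a b) {B : Type _} [Ring B] [Algebra F B] (f : H a b →ₐ[F] B) :
      ((q a b).compHom f).lift x = f x :=
    AlgHom.congr_fun (QuaternionAlgebra.lift.apply_symm_apply f) x
  obtain ⟨ψ⟩ := nonempty_algHom_matrix_two (A := A) hd₄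
    ((q _ _).compHom (Algebra.TensorProduct.includeLeft.comp Algebra.TensorProduct.includeLeft))
    ((q _ _).compHom (Algebra.TensorProduct.includeLeft.comp Algebra.TensorProduct.includeRight))
    ((q _ _).compHom Algebra.TensorProduct.includeRight)
    (fun x y ↦ by
      rw [hq, hq]
      exact (Algebra.TensorProduct.commute_includeLeft_includeRight x y).map
        (Algebra.TensorProduct.includeLeft (S := F)))
    (fun x y ↦ by
      rw [hq, hq]
      exact Algebra.TensorProduct.commute_includeLeft_includeRight _ y)
    (fun x y ↦ by
      rw [hq, hq]
      exact Algebra.TensorProduct.commute_includeLeft_includeRight _ y)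
  obtain ⟨χ⟩ := nonempty_algEquiv_matrix_of_algHom 8 hA (by norm_num)
    ((ψ.comp (Algebra.TensorProduct.congr (Algebra.TensorProduct.congr
      (Algebra.TensorProduct.congr (E c₁ d₁) (E c₂ d₂)) (E c₃ d₃))
      (E (c₁ + c₂ + c₃) d₄)).toAlgHom).comp φ.symm.toAlgHom)
  exact ⟨(Algebra.TensorProduct.congr
    (Algebra.TensorProduct.congr (E c₁ (d₁ * d₄)) (E c₂ (d₂ * d₄))) (E c₃ (d₃ * d₄))).trans χ⟩
end
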